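/- arXiv:2206.04552 — 3 statements merged into one kernel-verified Lean document; each statement's English description precedes it below -/
import Mathlib

section
/- Spectral representation of the non-vectorised kernel Stein discrepancy (Theorem 2, first part): assume additionally that ∫ ‖s‖⁴ dμ(s) < ∞. Then ∫_X ∫_X h(x,x') dQ(x) dQ(x') = ∫_X | ∫_X A(e^{i⟨s,·⟩})(x) dQ(x) |² dμ(s), and in particular both sides are finite. -/
open MeasureTheory ProbabilityTheory Complex Filter
open scoped RealInnerProductSpace

/-- The non-vectorised Stein kernel `h` associated to the kernel `k`, the covariance
operator `C` (with eigenbasis `e` and eigenvalues `l`) and the potential gradient `DU`. -/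
noncomputable def steinKernelH {X : Type*} [NormedAddCommGroup X] [InnerProductSpace ℝ X]
    (k : X → X → ℝ) (C : X →L[ℝ] X) (DU : X → X) (e : ℕ → X) (l : ℕ → ℝ)
    (x x' : X) : ℝ :=
  (∑' i, ∑' j, l i * l j *
      fderiv ℝ (fun y1 => fderiv ℝ (fun y2 =>
        fderiv ℝ (fun x1 => fderiv ℝ (fun x2 => k x2 y2) x1 (e i)) x (e i)) y1 (e j)) x' (e j))
  - (∑' i, l i *
      fderiv ℝ (fun y1 => fderiv ℝ (fun y2 =>
        fderiv ℝ (fun x1 => k x1 y2) x (x + C (DU x))) y1 (e i)) x' (e i))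
  - (∑' i, l i *
      fderiv ℝ (fun x1 => fderiv ℝ (fun x2 =>
        fderiv ℝ (fun y1 => k x2 y1) x' (x' + C (DU x'))) x1 (e i)) x (e i))
  + fderiv ℝ (fun y1 => fderiv ℝ (fun x1 => k x1 y1) x (x + C (DU x))) x' (x' + C (DU x'))

/-- The (non-vectorised) Stein operator
`A f(x) = ∑ᵢ λᵢ D²f(x)[eᵢ,eᵢ] − ⟨Df(x), x + C DU(x)⟩`, acting on complex-valued `f`. -/
noncomputable def steinA {X : Type*} [NormedAddCommGroup X] [InnerProductSpace ℝ X]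
    (C : X →L[ℝ] X) (DU : X → X) (e : ℕ → X) (l : ℕ → ℝ) (f : X → ℂ) (x : X) : ℂ :=
  (∑' i, (l i : ℂ) * fderiv ℝ (fun x1 => fderiv ℝ f x1 (e i)) x (e i))
    - fderiv ℝ f x (x + C (DU x))


namespace KSD

set_option linter.unusedSectionVars false

variable {X : Type*} [NormedAddCommGroup X] [InnerProductSpace ℝ X] [CompleteSpace X]
    [MeasurableSpace X] [BorelSpace X] [SecondCountableTopology X]

/-- The real part of the Fourier transform of `w dμ` at `x - y`. -/
noncomputable def KK (μ : Measure X) (w : X → ℂ) (x y : X) : ℝ :=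
  (∫ u, w u * Complex.exp ((⟪x - y, u⟫ : ℂ) * Complex.I) ∂μ).re

/-- Weights of polynomial growth of degree at most `m`. -/
def Adm (m : ℕ) (w : X → ℂ) : Prop :=
  Measurable w ∧ ∃ c : ℝ, ∀ u, ‖w u‖ ≤ c * (1 + ‖u‖) ^ m

lemma norm_e (r : ℝ) : ‖Complex.exp ((r : ℂ) * Complex.I)‖ = 1 :=
  Complex.norm_exp_ofReal_mul_I r

lemma Adm.mul_inner {m : ℕ} {w : X → ℂ} (hw : Adm m w) (c : ℂ) (v : X) :
    Adm (m + 1) (fun u => c * (⟪v, u⟫ : ℂ) * w u) := by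
  obtain ⟨hm, b, hb⟩ := hw
  refine ⟨by fun_prop, ‖c‖ * ‖v‖ * b, fun u => ?_⟩
  have h1 : ‖(⟪v, u⟫ : ℂ)‖ ≤ ‖v‖ * (1 + ‖u‖) := by
    rw [Complex.norm_real]
    refine (norm_inner_le_norm v u).trans ?_
    gcongr; linarith
  rw [norm_mul, norm_mul]
  calc ‖c‖ * ‖(⟪v, u⟫ : ℂ)‖ * ‖w u‖
      ≤ ‖c‖ * (‖v‖ * (1 + ‖u‖)) * (b * (1 + ‖u‖) ^ m) := by
        gcongr; exact hb u
    _ = _ := by ring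

lemma Adm.mul_sigma {m : ℕ} {w : X → ℂ} (hw : Adm m w) (c : ℂ) (C : X →L[ℝ] X) :
    Adm (m + 2) (fun u => c * (⟪C u, u⟫ : ℂ) * w u) := by
  obtain ⟨hm, b, hb⟩ := hw
  refine ⟨by fun_prop, ‖c‖ * ‖C‖ * b, fun u => ?_⟩
  have h1 : ‖(⟪C u, u⟫ : ℂ)‖ ≤ ‖C‖ * (1 + ‖u‖) ^ 2 := by
    rw [Complex.norm_real]
    refine (norm_inner_le_norm _ u).trans ?_
    have := C.le_opNorm u
    calc ‖C u‖ * ‖u‖ ≤ ‖C‖ * ‖u‖ * ‖u‖ := by gcongr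
      _ = ‖C‖ * ‖u‖ ^ 2 := by ring
      _ ≤ _ := by gcongr; linarith
  rw [norm_mul, norm_mul]
  calc ‖c‖ * ‖(⟪C u, u⟫ : ℂ)‖ * ‖w u‖
      ≤ ‖c‖ * (‖C‖ * (1 + ‖u‖) ^ 2) * (b * (1 + ‖u‖) ^ m) := by
        gcongr; exact hb u
    _ = _ := by ring

lemma integrable_pow (μ : Measure X) [IsFiniteMeasure μ]
    (hμ4 : Integrable (fun s => ‖s‖ ^ 4) μ) {m : ℕ} (hm : m ≤ 4) :
    Integrable (fun u : X => (1 + ‖u‖) ^ m) μ := by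
  refine Integrable.mono' (g := fun u => 8 * (1 + ‖u‖ ^ 4))
    (((integrable_const 1).add hμ4).const_mul 8) (by fun_prop) (ae_of_all _ fun u => ?_)
  rw [Real.norm_of_nonneg (by positivity)]
  have h0 := norm_nonneg u
  calc (1 + ‖u‖) ^ m ≤ (1 + ‖u‖) ^ 4 := pow_le_pow_right₀ (by linarith) hm
    _ ≤ _ := by
      have := add_pow_le (a := (1:ℝ)) (b := ‖u‖) zero_le_one h0 4
      norm_num at this
      linarith

lemma Adm.integrable {μ : Measure X} [IsFiniteMeasure μ]
    (hμ4 : Integrable (fun s => ‖s‖ ^ 4) μ) {m : ℕ} (hm : m ≤ 4) {w : X → ℂ} (hw : Adm m w) :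
    Integrable w μ := by
  obtain ⟨hm', b, hb⟩ := hw
  exact ((integrable_pow μ hμ4 hm).const_mul b).mono' hm'.aestronglyMeasurable (ae_of_all _ hb)

lemma Adm.integrable_mul {μ : Measure X} [IsFiniteMeasure μ]
    (hμ4 : Integrable (fun s => ‖s‖ ^ 4) μ) {m : ℕ} (hm : m ≤ 4) {w : X → ℂ} (hw : Adm m w)
    (z : X) :
    Integrable (fun u => w u * Complex.exp ((⟪z, u⟫ : ℂ) * Complex.I)) μ := by
  refine (hw.integrable hμ4 hm).mono ?_ (ae_of_all _ fun u => ?_)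
  · have := hw.1
    exact (by fun_prop : Measurable _).aestronglyMeasurable
  · rw [norm_mul, norm_e, mul_one]

lemma hasFDerivAt_F {μ : Measure X} [IsFiniteMeasure μ]
    (hμ4 : Integrable (fun s => ‖s‖ ^ 4) μ) {m : ℕ} (hm : m + 1 ≤ 4) {w : X → ℂ} (hw : Adm m w)
    (z : X) :
    ∃ D : X →L[ℝ] ℂ, HasFDerivAt
      (fun z => ∫ u, w u * Complex.exp ((⟪z, u⟫ : ℂ) * Complex.I) ∂μ) D z ∧
      ∀ v, D v = ∫ u, (Complex.I * (⟪v, u⟫ : ℂ) * w u) *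
        Complex.exp ((⟪z, u⟫ : ℂ) * Complex.I) ∂μ := by
  have hwm := hw.1
  obtain ⟨b, hb⟩ := hw.2
  let F' : X → X → (X →L[ℝ] ℂ) := fun z u =>
    (Complex.I * w u * Complex.exp ((⟪z, u⟫ : ℂ) * Complex.I)) •
      (Complex.ofRealCLM.comp (innerSL ℝ u))
  have hmeas : AEStronglyMeasurable (F' z) μ := by
    have h1 : Measurable fun u => Complex.I * w u * Complex.exp ((⟪z, u⟫ : ℂ) * Complex.I) := by
      fun_prop
    have h2 : Continuous fun u : X => Complex.ofRealCLM.comp (innerSL ℝ u) :=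
      (ContinuousLinearMap.compL ℝ X ℝ ℂ Complex.ofRealCLM).continuous.comp (innerSL ℝ).continuous
    exact AEStronglyMeasurable.smul h1.aestronglyMeasurable h2.aestronglyMeasurable
  have hbd : ∀ u y, ‖F' y u‖ ≤ b * (1 + ‖u‖) ^ (m + 1) := by
    intro u y
    have h1 : ‖Complex.ofRealCLM.comp (innerSL ℝ u)‖ ≤ 1 + ‖u‖ := by
      refine ContinuousLinearMap.opNorm_le_bound _ (by positivity) fun v => ?_
      simp only [ContinuousLinearMap.comp_apply, Complex.ofRealCLM_apply, Complex.norm_real,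
        innerSL_apply_apply]
      refine (norm_inner_le_norm u v).trans ?_
      gcongr; linarith
    simp only [F', norm_smul, norm_mul, norm_e, Complex.norm_I, one_mul, mul_one]
    calc _ ≤ (b * (1 + ‖u‖) ^ m) * (1 + ‖u‖) := by
          have := (norm_nonneg _).trans (hb u)
          gcongr; exact hb u
      _ = _ := by ring
  have hbi : Integrable (fun u : X => b * (1 + ‖u‖) ^ (m + 1)) μ :=
    (integrable_pow μ hμ4 hm).const_mul b
  have key := hasFDerivAt_integral_of_dominated_of_fderiv_le (𝕜 := ℝ) (μ := μ) (x₀ := z)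
    (F := fun z u => w u * Complex.exp ((⟪z, u⟫ : ℂ) * Complex.I)) (F' := F')
    (bound := fun u => b * (1 + ‖u‖) ^ (m + 1)) (s := Set.univ) Filter.univ_mem
    (Eventually.of_forall fun y => (hw.integrable_mul hμ4 (by omega) y).1)
    (hw.integrable_mul hμ4 (by omega) z) hmeas
    (ae_of_all _ fun u y _ => hbd u y) hbi
    (ae_of_all _ fun u y _ => by
      have h1 : HasFDerivAt (fun z : X => (⟪z, u⟫ : ℂ))
          (Complex.ofRealCLM.comp (innerSL ℝ u)) y := by
        have := (Complex.ofRealCLM.comp (innerSL ℝ u)).hasFDerivAt (x := y)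
        convert this using 2 with z
        simp [real_inner_comm]
      have h2 := ((h1.mul_const Complex.I).cexp).const_mul (w u)
      refine h2.congr_fderiv ?_
      simp only [F', smul_smul]
      congr 1
      ring)
  refine ⟨_, key, fun v => ?_⟩
  rw [ContinuousLinearMap.integral_apply (hbi.mono' hmeas (ae_of_all _ fun u => hbd u z))]
  congr 1
  ext u
  simp only [F', smul_apply, ContinuousLinearMap.comp_apply,
    Complex.ofRealCLM_apply, innerSL_apply_apply, smul_eq_mul, real_inner_comm u v]
  ring

lemma fderiv_left {μ : Measure X} [IsFiniteMeasure μ]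
    (hμ4 : Integrable (fun s => ‖s‖ ^ 4) μ) {m : ℕ} (hm : m + 1 ≤ 4) {w : X → ℂ} (hw : Adm m w)
    (x y v : X) :
    fderiv ℝ (fun x1 => KK μ w x1 y) x v = KK μ (fun u => Complex.I * (⟪v, u⟫ : ℂ) * w u) x y := by
  obtain ⟨D, hD, hDv⟩ := hasFDerivAt_F hμ4 hm hw (x - y)
  have h1 : HasFDerivAt (fun x1 : X => x1 - y) (ContinuousLinearMap.id ℝ X) x :=
    (hasFDerivAt_id x).sub_const y
  have h2 := Complex.reCLM.hasFDerivAt.comp x (hD.comp x h1)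
  have h3 : HasFDerivAt (fun x1 => KK μ w x1 y) _ x := h2
  rw [h3.fderiv]
  simp [KK, hDv]

lemma fderiv_right {μ : Measure X} [IsFiniteMeasure μ]
    (hμ4 : Integrable (fun s => ‖s‖ ^ 4) μ) {m : ℕ} (hm : m + 1 ≤ 4) {w : X → ℂ} (hw : Adm m w)
    (x y v : X) :
    fderiv ℝ (fun y1 => KK μ w x y1) y v =
      KK μ (fun u => (-Complex.I) * (⟪v, u⟫ : ℂ) * w u) x y := by
  obtain ⟨D, hD, hDv⟩ := hasFDerivAt_F hμ4 hm hw (x - y)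
  have h1 : HasFDerivAt (fun y1 : X => x - y1) (-ContinuousLinearMap.id ℝ X) y :=
    (hasFDerivAt_id y).const_sub x
  have h2 := Complex.reCLM.hasFDerivAt.comp y (hD.comp y h1)
  have h3 : HasFDerivAt (fun y1 => KK μ w x y1) _ y := h2
  rw [h3.fderiv]
  simp [KK, hDv, integral_neg]

lemma hasSum_sigma (C : X →L[ℝ] X) (hCsa : IsSelfAdjoint C)
    (e : HilbertBasis ℕ ℝ X) (l : ℕ → ℝ) (hCe : ∀ i, C (e i) = l i • e i) (u : X) :
    HasSum (fun i => l i * ⟪e i, u⟫ ^ 2) ⟪C u, u⟫ := by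
  have h := e.hasSum_inner_mul_inner (C u) u
  suffices hfun : (fun i => l i * ⟪e i, u⟫ ^ 2) = fun i => ⟪C u, e i⟫ * ⟪e i, u⟫ by
    rw [hfun]; exact h
  ext i
  have := hCsa.isSymmetric u (e i)
  simp only [ContinuousLinearMap.coe_coe] at this
  rw [this, hCe, inner_smul_right, real_inner_comm]
  ring

lemma tsum_KK {μ : Measure X} [IsFiniteMeasure μ]
    (hμ4 : Integrable (fun s => ‖s‖ ^ 4) μ) (C : X →L[ℝ] X) (hCsa : IsSelfAdjoint C)
    (e : HilbertBasis ℕ ℝ X) (l : ℕ → ℝ) (hl : ∀ i, 0 < l i)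
    (hCe : ∀ i, C (e i) = l i • e i) (hltr : Summable l)
    {m : ℕ} (hm : m + 2 ≤ 4) {w : X → ℂ} (hw : Adm m w) (c : ℂ) (hc : c * c = -1) (x y : X) :
    ∑' i, l i * KK μ (fun u => c * (⟪e i, u⟫ : ℂ) * (c * (⟪e i, u⟫ : ℂ) * w u)) x y
      = KK μ (fun u => (-1) * (⟪C u, u⟫ : ℂ) * w u) x y := by
  have hcn : ‖c‖ = 1 := by
    have : ‖c * c‖ = 1 := by rw [hc]; simp
    rw [norm_mul] at this
    nlinarith [norm_nonneg c]
  obtain ⟨b, hb⟩ := hw.2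
  let G : ℕ → X → ℂ := fun i u => (l i : ℂ) *
    ((c * (⟪e i, u⟫ : ℂ) * (c * (⟪e i, u⟫ : ℂ) * w u)) *
      Complex.exp ((⟪x - y, u⟫ : ℂ) * Complex.I))
  have hint : ∀ i, Integrable (G i) μ := fun i =>
    (((hw.mul_inner c (e i)).mul_inner c (e i)).integrable_mul hμ4 hm (x - y)).const_mul _
  have hbd : ∀ i u, ‖G i u‖ ≤ l i * (b * (1 + ‖u‖) ^ (m + 2)) := by
    intro i u
    simp only [G, norm_mul, norm_e, hcn, Complex.norm_real, one_mul, mul_one]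
    rw [Real.norm_of_nonneg (hl i).le]
    have h1 : ‖⟪e i, u⟫‖ ≤ 1 + ‖u‖ := by
      refine (norm_inner_le_norm _ _).trans ?_
      rw [e.orthonormal.1 i]; linarith
    have h2 := (norm_nonneg _).trans (hb u)
    have h3 := (hl i).le
    calc _ ≤ l i * ((1 + ‖u‖) * ((1 + ‖u‖) * (b * (1 + ‖u‖) ^ m))) := by
          gcongr; exact hb u
      _ = _ := by ring
  have hsum : Summable fun i => ∫ u, ‖G i u‖ ∂μ := by
    refine Summable.of_nonneg_of_le (fun i => integral_nonneg fun u => norm_nonneg _)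
      (fun i => ?_) (hltr.mul_right (∫ u, b * (1 + ‖u‖) ^ (m + 2) ∂μ))
    rw [← integral_const_mul]
    exact integral_mono (hint i).norm (((integrable_pow μ hμ4 hm).const_mul b).const_mul _) (hbd i)
  have key := hasSum_integral_of_summable_integral_norm hint hsum
  have key2 := Complex.hasSum_re key
  have h1 : ∀ i, (∫ u, G i u ∂μ).re
      = l i * KK μ (fun u => c * (⟪e i, u⟫ : ℂ) * (c * (⟪e i, u⟫ : ℂ) * w u)) x y := by
    intro i
    simp only [G, KK]
    rw [integral_const_mul, Complex.re_ofReal_mul]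
  simp only [h1] at key2
  rw [key2.tsum_eq, KK]
  congr 2
  ext u
  have h2 := (Complex.hasSum_ofReal.2 (hasSum_sigma C hCsa e l hCe u)).mul_right
    (-(w u * Complex.exp ((⟪x - y, u⟫ : ℂ) * Complex.I)))
  have h3 : ∀ i, G i u = ((l i * ⟪e i, u⟫ ^ 2 : ℝ) : ℂ) *
      (-(w u * Complex.exp ((⟪x - y, u⟫ : ℂ) * Complex.I))) := by
    intro i
    simp only [G]
    push_cast
    linear_combination ((l i : ℂ) * ⟪e i, u⟫ ^ 2 * w u *
      Complex.exp ((⟪x - y, u⟫ : ℂ) * Complex.I)) * hc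
  simp only [h3]
  rw [h2.tsum_eq]
  ring

end KSD

namespace KSD

variable {X : Type*} [NormedAddCommGroup X] [InnerProductSpace ℝ X] [CompleteSpace X]
    [MeasurableSpace X] [BorelSpace X] [SecondCountableTopology X]

/-- The Stein operator applied to the character `e^{i⟨s,·⟩}`, explicitly. -/
noncomputable def aa (C : X →L[ℝ] X) (DU : X → X) (s x : X) : ℂ :=
  Complex.exp ((⟪s, x⟫ : ℂ) * Complex.I) *
    (-(⟪C s, s⟫ : ℂ) - Complex.I * (⟪x + C (DU x), s⟫ : ℂ))

lemma KK_comb {μ : Measure X} [IsFiniteMeasure μ] (hμ4 : Integrable (fun s => ‖s‖ ^ 4) μ)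
    {m1 m2 m3 m4 : ℕ} (h1 : m1 ≤ 4) (h2 : m2 ≤ 4) (h3 : m3 ≤ 4) (h4 : m4 ≤ 4)
    {w1 w2 w3 w4 : X → ℂ} (hw1 : Adm m1 w1) (hw2 : Adm m2 w2) (hw3 : Adm m3 w3) (hw4 : Adm m4 w4)
    (x y : X) :
    KK μ w1 x y - KK μ w2 x y - KK μ w3 x y + KK μ w4 x y =
      KK μ (fun u => w1 u - w2 u - w3 u + w4 u) x y := by
  have i1 := hw1.integrable_mul hμ4 h1 (x - y)
  have i2 := hw2.integrable_mul hμ4 h2 (x - y)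
  have i3 := hw3.integrable_mul hμ4 h3 (x - y)
  have i4 := hw4.integrable_mul hμ4 h4 (x - y)
  simp only [KK, add_mul, sub_mul]
  have e1 := integral_add ((i1.sub i2).sub i3) i4
  have e2 := integral_sub (i1.sub i2) i3
  have e3 := integral_sub i1 i2
  simp only [Pi.sub_apply] at e1 e2 e3
  rw [e1, e2, e3]
  simp

lemma steinKernelH_eq {μ : Measure X} [IsFiniteMeasure μ]
    (hμ4 : Integrable (fun s => ‖s‖ ^ 4) μ) (C : X →L[ℝ] X) (hCsa : IsSelfAdjoint C)
    (DU : X → X)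
    (e : HilbertBasis ℕ ℝ X) (l : ℕ → ℝ) (hl : ∀ i, 0 < l i)
    (hCe : ∀ i, C (e i) = l i • e i) (hltr : Summable l)
    (k : X → X → ℝ)
    (hk : ∀ x y : X, (k x y : ℂ) = ∫ u, Complex.exp ((⟪x - y, u⟫ : ℂ) * Complex.I) ∂μ)
    (x x' : X) :
    steinKernelH k C DU (fun i => e i) l x x' =
      (∫ s, aa C DU s x * (starRingEnd ℂ) (aa C DU s x') ∂μ).re := by
  let W : X → ℂ := fun _ => 1
  have hW : Adm 0 W := ⟨measurable_const, 1, fun u => by simp [W]⟩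
  have hk' : k = fun x y => KK μ W x y := by
    ext x y
    rw [KK]
    simp only [W, one_mul]
    rw [← hk, Complex.ofReal_re]
  set b := x + C (DU x) with hb
  set b' := x' + C (DU x') with hb'
  have T1 : ∀ i j, fderiv ℝ (fun y1 => fderiv ℝ (fun y2 =>
        fderiv ℝ (fun x1 => fderiv ℝ (fun x2 => k x2 y2) x1 (e i)) x (e i)) y1 (e j)) x' (e j)
      = KK μ (fun u => (-Complex.I) * (⟪e j, u⟫ : ℂ) * ((-Complex.I) * (⟪e j, u⟫ : ℂ) *
          (Complex.I * (⟪e i, u⟫ : ℂ) * (Complex.I * (⟪e i, u⟫ : ℂ) * W u)))) x x' := by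
    intro i j
    have A1 := hW.mul_inner Complex.I (e i)
    have A2 := A1.mul_inner Complex.I (e i)
    have A3 := A2.mul_inner (-Complex.I) (e j)
    simp only [hk', fderiv_left hμ4 (by norm_num) hW, fderiv_left hμ4 (by norm_num) A1,
      fderiv_right hμ4 (by norm_num) A2, fderiv_right hμ4 (by norm_num) A3]
  have T2 : ∀ i, fderiv ℝ (fun y1 => fderiv ℝ (fun y2 =>
        fderiv ℝ (fun x1 => k x1 y2) x b) y1 (e i)) x' (e i)
      = KK μ (fun u => (-Complex.I) * (⟪e i, u⟫ : ℂ) * ((-Complex.I) * (⟪e i, u⟫ : ℂ) *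
          (Complex.I * (⟪b, u⟫ : ℂ) * W u))) x x' := by
    intro i
    have A1 := hW.mul_inner Complex.I b
    have A2 := A1.mul_inner (-Complex.I) (e i)
    simp only [hk', fderiv_left hμ4 (by norm_num) hW,
      fderiv_right hμ4 (by norm_num) A1, fderiv_right hμ4 (by norm_num) A2]
  have T3 : ∀ i, fderiv ℝ (fun x1 => fderiv ℝ (fun x2 =>
        fderiv ℝ (fun y1 => k x2 y1) x' b') x1 (e i)) x (e i)
      = KK μ (fun u => Complex.I * (⟪e i, u⟫ : ℂ) * (Complex.I * (⟪e i, u⟫ : ℂ) *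
          ((-Complex.I) * (⟪b', u⟫ : ℂ) * W u))) x x' := by
    intro i
    have A1 := hW.mul_inner (-Complex.I) b'
    have A2 := A1.mul_inner Complex.I (e i)
    simp only [hk', fderiv_right hμ4 (by norm_num) hW,
      fderiv_left hμ4 (by norm_num) A1, fderiv_left hμ4 (by norm_num) A2]
  have T4 : fderiv ℝ (fun y1 => fderiv ℝ (fun x1 => k x1 y1) x b) x' b'
      = KK μ (fun u => (-Complex.I) * (⟪b', u⟫ : ℂ) * (Complex.I * (⟪b, u⟫ : ℂ) * W u)) x x' := by
    have A1 := hW.mul_inner Complex.I b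
    simp only [hk', fderiv_left hμ4 (by norm_num) hW, fderiv_right hμ4 (by norm_num) A1]
  have hI : Complex.I * Complex.I = -1 := Complex.I_mul_I
  have hI' : (-Complex.I) * (-Complex.I) = -1 := by rw [neg_mul_neg, hI]
  have S2 := tsum_KK hμ4 C hCsa e l hl hCe hltr (by norm_num) (hW.mul_inner Complex.I b)
    (-Complex.I) hI' x x'
  have S3 := tsum_KK hμ4 C hCsa e l hl hCe hltr (by norm_num) (hW.mul_inner (-Complex.I) b')
    Complex.I hI x x'
  have S1 : ∑' i, ∑' j, l i * l j * KK μ (fun u => (-Complex.I) * (⟪e j, u⟫ : ℂ) *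
      ((-Complex.I) * (⟪e j, u⟫ : ℂ) *
          (Complex.I * (⟪e i, u⟫ : ℂ) * (Complex.I * (⟪e i, u⟫ : ℂ) * W u)))) x x'
      = KK μ (fun u => (-1) * (⟪C u, u⟫ : ℂ) * ((-1) * (⟪C u, u⟫ : ℂ) * W u)) x x' := by
    rw [← tsum_KK hμ4 C hCsa e l hl hCe hltr (by norm_num) (hW.mul_sigma (-1) C)
      Complex.I hI x x']
    congr 1
    ext i
    have := tsum_KK hμ4 C hCsa e l hl hCe hltr (by norm_num)
      ((hW.mul_inner Complex.I (e i)).mul_inner Complex.I (e i)) (-Complex.I) hI' x x'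
    simp only [mul_assoc (l i)]
    rw [tsum_mul_left, this]
    congr 2
    ext u
    ring
  unfold steinKernelH
  simp only [← hb, ← hb', T1, T2, T3, T4]
  rw [S1, S2, S3, KK_comb hμ4 (by norm_num) (by norm_num) (by norm_num) (by norm_num)
    ((hW.mul_sigma (-1) C).mul_sigma (-1) C)
    ((hW.mul_inner Complex.I b).mul_sigma (-1) C)
    ((hW.mul_inner (-Complex.I) b').mul_sigma (-1) C)
    ((hW.mul_inner Complex.I b).mul_inner (-Complex.I) b'), KK]
  congr 2
  ext u
  have hexp : Complex.exp ((⟪x - x', u⟫ : ℂ) * Complex.I) =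
      Complex.exp ((⟪u, x⟫ : ℂ) * Complex.I) * Complex.exp (-((⟪u, x'⟫ : ℂ) * Complex.I)) := by
    rw [← Complex.exp_add, inner_sub_left, real_inner_comm u x, real_inner_comm u x']
    congr 1
    push_cast
    ring
  simp only [aa, W, hexp, map_mul, map_sub, map_neg, Complex.conj_I, Complex.conj_ofReal,
    ← Complex.exp_conj, ← hb, ← hb', mul_neg]
  ring_nf

lemma hasFDerivAt_char (s x : X) :
    HasFDerivAt (fun y : X => Complex.exp ((⟪s, y⟫ : ℂ) * Complex.I))
      ((Complex.exp ((⟪s, x⟫ : ℂ) * Complex.I) * Complex.I) •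
        Complex.ofRealCLM.comp (innerSL ℝ s)) x := by
  have h1 : HasFDerivAt (fun z : X => (⟪s, z⟫ : ℂ))
      (Complex.ofRealCLM.comp (innerSL ℝ s)) x :=
    (Complex.ofRealCLM.comp (innerSL ℝ s)).hasFDerivAt (x := x)
  refine ((h1.mul_const Complex.I).cexp).congr_fderiv ?_
  rw [smul_smul]

lemma steinA_eq (C : X →L[ℝ] X) (hCsa : IsSelfAdjoint C)
    (DU : X → X) (e : HilbertBasis ℕ ℝ X) (l : ℕ → ℝ)
    (hCe : ∀ i, C (e i) = l i • e i) (s x : X) :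
    steinA C DU (fun i => e i) l (fun y => Complex.exp ((⟪s, y⟫ : ℂ) * Complex.I)) x
      = aa C DU s x := by
  have h1 : ∀ y v : X, fderiv ℝ (fun y : X => Complex.exp ((⟪s, y⟫ : ℂ) * Complex.I)) y v
      = Complex.exp ((⟪s, y⟫ : ℂ) * Complex.I) * (Complex.I * (⟪v, s⟫ : ℂ)) := by
    intro y v
    rw [(hasFDerivAt_char s y).fderiv]
    simp only [smul_apply, ContinuousLinearMap.comp_apply, Complex.ofRealCLM_apply,
      innerSL_apply_apply, smul_eq_mul, real_inner_comm v s]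
    ring
  have h2 : ∀ v : X, fderiv ℝ (fun y : X => Complex.exp ((⟪s, y⟫ : ℂ) * Complex.I) *
        (Complex.I * (⟪v, s⟫ : ℂ))) x v
      = Complex.exp ((⟪s, x⟫ : ℂ) * Complex.I) * (-(⟪v, s⟫ : ℂ) ^ 2) := by
    intro v
    rw [fderiv_mul_const (hasFDerivAt_char s x).differentiableAt, smul_apply, h1, smul_eq_mul]
    linear_combination (Complex.exp ((⟪s, x⟫ : ℂ) * Complex.I) * (⟪v, s⟫ : ℂ) ^ 2) *
      Complex.I_mul_I
  unfold steinA
  simp only [h1, h2]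
  have h3 := (Complex.hasSum_ofReal.2 (hasSum_sigma C hCsa e l hCe s)).mul_right
    (-Complex.exp ((⟪s, x⟫ : ℂ) * Complex.I))
  have h4 : ∀ i, (l i : ℂ) * (Complex.exp ((⟪s, x⟫ : ℂ) * Complex.I) * (-(⟪e i, s⟫ : ℂ) ^ 2))
      = ((l i * ⟪e i, s⟫ ^ 2 : ℝ) : ℂ) * (-Complex.exp ((⟪s, x⟫ : ℂ) * Complex.I)) := by
    intro i
    push_cast
    ring
  simp only [h4]
  rw [h3.tsum_eq, aa]
  ring

lemma measurable_DU (U : X → ℝ) (DU : X → X)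
    (hU : ∀ x, HasFDerivAt U ((InnerProductSpace.toDual ℝ X) (DU x) : X →L[ℝ] ℝ) x) :
    Measurable DU := by
  have h1 := measurable_fderiv ℝ U
  have h2 : DU = fun x => (InnerProductSpace.toDual ℝ X).symm (fderiv ℝ U x) := by
    ext1 x
    rw [(hU x).fderiv, LinearIsometryEquiv.symm_apply_apply]
  rw [h2]
  exact (InnerProductSpace.toDual ℝ X).symm.continuous.measurable.comp h1

lemma norm_aa_le (C : X →L[ℝ] X) (DU : X → X) (s x : X) :
    ‖aa C DU s x‖ ≤ (‖C‖ + 1) * (1 + ‖s‖) ^ 2 * (1 + ‖x + C (DU x)‖) := by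
  rw [aa, norm_mul, norm_e, one_mul]
  refine (norm_sub_le _ _).trans ?_
  rw [norm_neg, norm_mul, Complex.norm_I, one_mul, Complex.norm_real, Complex.norm_real]
  have h1 := norm_inner_le_norm (𝕜 := ℝ) (C s) s
  have h2 := norm_inner_le_norm (𝕜 := ℝ) (x + C (DU x)) s
  have h3 := C.le_opNorm s
  have hs := norm_nonneg s
  have hc := norm_nonneg C
  set B := ‖x + C (DU x)‖
  have hB : 0 ≤ B := norm_nonneg _
  have h4 : ‖C s‖ * ‖s‖ ≤ ‖C‖ * ‖s‖ * ‖s‖ := by gcongr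
  have : (‖C‖ + 1) * (1 + ‖s‖) ^ 2 * (1 + B) - (‖C‖ * ‖s‖ * ‖s‖ + B * ‖s‖)
      = ‖C‖ * (1 + 2 * ‖s‖) + ‖C‖ * (1 + ‖s‖) ^ 2 * B + (1 + ‖s‖) ^ 2
        + (1 + ‖s‖ + ‖s‖ ^ 2) * B := by ring
  have h5 : 0 ≤ ‖C‖ * (1 + 2 * ‖s‖) + ‖C‖ * (1 + ‖s‖) ^ 2 * B + (1 + ‖s‖) ^ 2
        + (1 + ‖s‖ + ‖s‖ ^ 2) * B := by positivity
  linarith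

end KSD

/-- **Spectral representation of the non-vectorised kernel Stein discrepancy**
(Theorem 2, first part). -/
theorem ksd_nonvectorised_spectral_representation
    {X : Type*} [NormedAddCommGroup X] [InnerProductSpace ℝ X] [CompleteSpace X]
    [MeasurableSpace X] [BorelSpace X] [SecondCountableTopology X]
    -- the covariance operator and its eigendecomposition
    (C : X →L[ℝ] X) (hCsa : IsSelfAdjoint C)
    (e : HilbertBasis ℕ ℝ X) (l : ℕ → ℝ) (hl : ∀ i, 0 < l i)
    (hCe : ∀ i, C (e i) = l i • e i) (hltr : Summable l)
    -- the potential `U` and its gradient `DU`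
    (U : X → ℝ) (DU : X → X)
    (hU : ∀ x, HasFDerivAt U ((InnerProductSpace.toDual ℝ X) (DU x) : X →L[ℝ] ℝ) x)
    -- the Gaussian reference measure `N_C` and the normalising constant of the Gibbs target
    (NC : Measure X) [IsProbabilityMeasure NC]
    (hNC : ∀ y : X, Measure.map (fun x => ⟪y, x⟫) NC
      = gaussianReal 0 (Real.toNNReal ⟪C y, y⟫))
    (hexpU : Integrable (fun x => Real.exp (-U x)) NC)
    (hZpos : 0 < ∫ x, Real.exp (-U x) ∂NC)
    -- the candidate measure `Q` and its moment conditions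
    (Q : Measure X) [IsProbabilityMeasure Q]
    (hQ2 : Integrable (fun x => ‖x‖ ^ 2) Q)
    (hQU : Integrable (fun x => ‖C (DU x)‖) Q)
    -- the spectral measure `μ` and the kernel `k`
    (μ : Measure X) [IsFiniteMeasure μ]
    (hμsymm : Measure.map (fun u => -u) μ = μ)
    (hμ4 : Integrable (fun s => ‖s‖ ^ 4) μ)
    (k : X → X → ℝ)
    (hk : ∀ x y : X, (k x y : ℂ) = ∫ u, Complex.exp ((⟪x - y, u⟫ : ℂ) * Complex.I) ∂μ) :
    Integrable (fun p : X × X =>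
        steinKernelH k C DU (fun i => e i) l p.1 p.2) (Q.prod Q) ∧
    Integrable (fun s : X =>
        ‖∫ x, steinA C DU (fun i => e i) l
          (fun y => Complex.exp ((⟪s, y⟫ : ℂ) * Complex.I)) x ∂Q‖ ^ 2) μ ∧
    ∫ x, ∫ x', steinKernelH k C DU (fun i => e i) l x x' ∂Q ∂Q
      = ∫ s, ‖∫ x, steinA C DU (fun i => e i) l
          (fun y => Complex.exp ((⟪s, y⟫ : ℂ) * Complex.I)) x ∂Q‖ ^ 2 ∂μ := by
  have hDU := KSD.measurable_DU U DU hU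
  have hH := KSD.steinKernelH_eq hμ4 C hCsa DU e l hl hCe hltr k hk
  have hA := KSD.steinA_eq C hCsa DU e l hCe
  simp only [hA]
  let f : X × X → X → ℂ := fun p s =>
    KSD.aa C DU s p.1 * (starRingEnd ℂ) (KSD.aa C DU s p.2)
  have hH' : ∀ x x', steinKernelH k C DU (fun i => e i) l x x' = (∫ s, f (x, x') s ∂μ).re := hH
  simp only [hH']
  have hg : Integrable (fun x : X => 1 + ‖x + C (DU x)‖) Q := by
    have hx : Integrable (fun x : X => ‖x‖) Q := by
      refine ((integrable_const (1 : ℝ)).add hQ2).mono' (by fun_prop) (ae_of_all _ fun x => ?_)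
      simp only [norm_norm, Pi.add_apply]
      nlinarith [sq_nonneg (‖x‖ - 1)]
    refine ((integrable_const (1 : ℝ)).add (hx.add hQU)).mono'
      (by fun_prop : Measurable _).aestronglyMeasurable (ae_of_all _ fun x => ?_)
    rw [Real.norm_of_nonneg (by positivity)]
    simp only [Pi.add_apply]
    gcongr
    exact norm_add_le _ _
  have hmeas : Measurable (fun q : X × X => KSD.aa C DU q.1 q.2) := by
    unfold KSD.aa
    fun_prop
  have hf : Integrable (Function.uncurry f) ((Q.prod Q).prod μ) := by
    have hdom := (hg.mul_prod hg).mul_prod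
      ((KSD.integrable_pow μ hμ4 le_rfl).const_mul ((‖C‖ + 1) ^ 2))
    refine hdom.mono' ?_ (ae_of_all _ fun q => ?_)
    · have m1 : Measurable fun q : (X × X) × X => KSD.aa C DU q.2 q.1.1 :=
        hmeas.comp (by fun_prop : Measurable fun q : (X × X) × X => (q.2, q.1.1))
      have m2 : Measurable fun q : (X × X) × X => KSD.aa C DU q.2 q.1.2 :=
        hmeas.comp (by fun_prop : Measurable fun q : (X × X) × X => (q.2, q.1.2))
      exact (m1.mul (Complex.continuous_conj.measurable.comp m2)).aestronglyMeasurable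
    · simp only [Function.uncurry, f, norm_mul, RCLike.norm_conj]
      calc _ ≤ ((‖C‖ + 1) * (1 + ‖q.2‖) ^ 2 * (1 + ‖q.1.1 + C (DU q.1.1)‖)) *
            ((‖C‖ + 1) * (1 + ‖q.2‖) ^ 2 * (1 + ‖q.1.2 + C (DU q.1.2)‖)) := by
            gcongr
            · exact KSD.norm_aa_le C DU _ _
            · exact KSD.norm_aa_le C DU _ _
        _ = _ := by ring
  have hsq : ∀ s, ∫ p, f p s ∂(Q.prod Q) = ((‖∫ x, KSD.aa C DU s x ∂Q‖ ^ 2 : ℝ) : ℂ) := by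
    intro s
    have h1 := integral_prod_mul (μ := Q) (ν := Q) (fun x => KSD.aa C DU s x)
      (fun x => (starRingEnd ℂ) (KSD.aa C DU s x))
    simp only [f]
    rw [h1, integral_conj, Complex.mul_conj, Complex.normSq_eq_norm_sq]
  have hI1 : Integrable (fun p : X × X => (∫ s, f p s ∂μ).re) (Q.prod Q) :=
    hf.integral_prod_left.re
  refine ⟨hI1, ?_, ?_⟩
  · have := hf.integral_prod_right.re
    simp only [Function.uncurry_apply_pair, hsq] at this
    simpa only [RCLike.re_to_complex, Complex.ofReal_re] using this
  · rw [← integral_prod (fun p : X × X => (∫ s, f p s ∂μ).re) hI1]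
    have h1 : ∫ p : X × X, (∫ s, f p s ∂μ).re ∂(Q.prod Q)
        = (∫ p : X × X, ∫ s, f p s ∂μ ∂(Q.prod Q)).re :=
      integral_re hf.integral_prod_left
    rw [h1, integral_integral_swap hf]
    simp only [hsq]
    rw [integral_complex_ofReal, Complex.ofReal_re]
end

section
/- Spectral representation of the vectorised kernel Stein discrepancy (Theorem 2, second part): assume additionally that ∫ ‖s‖² dμ(s) < ∞. Then ∫_X ∫_X h_v(x,x') dQ(x) dQ(x') = ∫_X ‖ ∫_X Γ(e^{i⟨s,·⟩})(x) dQ(x) ‖²_{X_ℂ} dμ(s), and in particular both sides are finite. -/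
open MeasureTheory ProbabilityTheory Complex Filter
open scoped RealInnerProductSpace

/-- The vectorised Stein kernel `h_v` associated to the kernel `k`, the covariance
operator `C` (with eigenbasis `e` and eigenvalues `l`) and the potential gradient `DU`.
The partial Fréchet derivatives `D₁k`, `D₂k` (Riesz identifications) are paired with
vectors by applying the corresponding directional derivatives. -/
noncomputable def steinKernelHv {X : Type*} [NormedAddCommGroup X] [InnerProductSpace ℝ X]
    (k : X → X → ℝ) (C : X →L[ℝ] X) (DU : X → X) (e : ℕ → X) (l : ℕ → ℝ)
    (x x' : X) : ℝ :=
  (∑' i, l i ^ 2 *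
      fderiv ℝ (fun y1 => fderiv ℝ (fun x1 => k x1 y1) x (e i)) x' (e i))
  - fderiv ℝ (fun x1 => k x1 x') x (C x' + C (C (DU x')))
  - fderiv ℝ (fun y1 => k x y1) x' (C x + C (C (DU x)))
  + k x x' * ⟪x + C (DU x), x' + C (DU x')⟫

/-- Real part of `Γ f(x) = C Df(x) − (x + C DU(x)) f(x) ∈ X_ℂ`, where `Df(x) ∈ X_ℂ` is the
Riesz representation of the Fréchet derivative of the complex-valued function `f`. -/
noncomputable def steinGammaRe {X : Type*} [NormedAddCommGroup X] [InnerProductSpace ℝ X]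
    [CompleteSpace X] (C : X →L[ℝ] X) (DU : X → X) (f : X → ℂ) (x : X) : X :=
  C ((InnerProductSpace.toDual ℝ X).symm (Complex.reCLM.comp (fderiv ℝ f x)))
    - (f x).re • (x + C (DU x))

/-- Imaginary part of `Γ f(x) = C Df(x) − (x + C DU(x)) f(x) ∈ X_ℂ`. -/
noncomputable def steinGammaIm {X : Type*} [NormedAddCommGroup X] [InnerProductSpace ℝ X]
    [CompleteSpace X] (C : X →L[ℝ] X) (DU : X → X) (f : X → ℂ) (x : X) : X :=
  C ((InnerProductSpace.toDual ℝ X).symm (Complex.imCLM.comp (fderiv ℝ f x)))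
    - (f x).im • (x + C (DU x))

section helpers

variable {X : Type*} [NormedAddCommGroup X] [InnerProductSpace ℝ X]

lemma aux_hasFDerivAt [MeasurableSpace X] [BorelSpace X] [SecondCountableTopology X]
    [CompleteSpace X]
    (μ : Measure X) (φ φ' : ℝ → ℝ) (hφ : ∀ t, HasDerivAt φ (φ' t) t) (hφ'c : Continuous φ')
    (hb : ∀ t, |φ t| ≤ 1) (hb' : ∀ t, |φ' t| ≤ 1) (w : X → ℝ) (hw : Continuous w)
    (hwi : Integrable w μ) (hwi' : Integrable (fun u => |w u| * ‖u‖) μ) (z : X) :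
    HasFDerivAt (fun z => ∫ u, φ ⟪z, u⟫ * w u ∂μ)
      (∫ u, (φ' ⟪z, u⟫ * w u) • innerSL ℝ u ∂μ) z ∧
    ∀ v, (∫ u, (φ' ⟪z, u⟫ * w u) • innerSL ℝ u ∂μ) v = ∫ u, φ' ⟪z, u⟫ * w u * ⟪u, v⟫ ∂μ := by
  have hφc : Continuous φ := continuous_iff_continuousAt.2 fun t => (hφ t).continuousAt
  have hbound : ∀ z u : X, ‖(φ' ⟪z, u⟫ * w u) • innerSL ℝ u‖ ≤ |w u| * ‖u‖ := by
    intro z u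
    rw [norm_smul, innerSL_apply_norm, Real.norm_eq_abs, abs_mul]
    gcongr
    exact mul_le_of_le_one_left (abs_nonneg _) (hb' _)
  have hmeas : ∀ z : X, AEStronglyMeasurable (fun u => (φ' ⟪z, u⟫ * w u) • innerSL ℝ u) μ := by
    intro z
    haveI : SecondCountableTopologyEither X (X →L[ℝ] ℝ) :=
      secondCountableTopologyEither_of_left X _
    apply Continuous.aestronglyMeasurable
    exact ((hφ'c.comp (by fun_prop)).mul hw).smul (innerSL ℝ).continuous
  have hmeas0 : ∀ z : X, AEStronglyMeasurable (fun u => φ ⟪z, u⟫ * w u) μ := by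
    intro z
    apply Continuous.aestronglyMeasurable
    exact (hφc.comp (by fun_prop)).mul hw
  constructor
  · refine hasFDerivAt_integral_of_dominated_of_fderiv_le (s := Set.univ) (𝕜 := ℝ)
      (F := fun z u => φ ⟪z, u⟫ * w u) (F' := fun z u => (φ' ⟪z, u⟫ * w u) • innerSL ℝ u)
      (bound := fun u => |w u| * ‖u‖)
      univ_mem ?_ ?_ (hmeas z) ?_ hwi' ?_
    · exact Eventually.of_forall hmeas0
    · refine hwi.mono (hmeas0 z) (Eventually.of_forall fun u => ?_)
      rw [norm_mul]
      exact mul_le_of_le_one_left (norm_nonneg _) (hb _)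
    · exact Eventually.of_forall fun u z _ => hbound z u
    · refine Eventually.of_forall fun u z _ => ?_
      have h1 : HasFDerivAt (fun z : X => ⟪z, u⟫) (innerSL ℝ u) z := by
        have := (innerSL ℝ u).hasFDerivAt (x := z)
        refine this.congr_of_eventuallyEq (Eventually.of_forall fun y => ?_)
        simp [real_inner_comm]
      have h2 := ((hφ ⟪z, u⟫).comp_hasFDerivAt z h1).mul_const (w u)
      rw [smul_smul, mul_comm] at h2
      exact h2
  · intro v
    have hi : Integrable (fun u => (φ' ⟪z, u⟫ * w u) • innerSL ℝ u) μ :=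
      hwi'.mono' (hmeas z) (Eventually.of_forall fun u => hbound z u)
    rw [ContinuousLinearMap.integral_apply hi]
    simp

lemma gamma_fderiv (s x : X) :
    HasFDerivAt (fun y : X => Complex.exp ((⟪s, y⟫ : ℂ) * Complex.I))
      ((Complex.exp ((⟪s, x⟫ : ℂ) * Complex.I) * Complex.I) •
        (Complex.ofRealCLM.comp (innerSL ℝ s))) x := by
  have h1 : HasFDerivAt (fun y : X => ((⟪s, y⟫ : ℝ) : ℂ)) (Complex.ofRealCLM.comp (innerSL ℝ s)) x :=
    (Complex.ofRealCLM.comp (innerSL ℝ s)).hasFDerivAt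
  have h2 := (h1.mul_const Complex.I).cexp
  convert h2 using 1
  ext v
  simp
  ring

variable [CompleteSpace X]

lemma gammaRe_eq (C : X →L[ℝ] X) (DU : X → X) (s x : X) :
    steinGammaRe C DU (fun y => Complex.exp ((⟪s, y⟫ : ℂ) * Complex.I)) x
      = -(Real.sin ⟪s, x⟫) • C s - Real.cos ⟪s, x⟫ • (x + C (DU x)) := by
  unfold steinGammaRe
  rw [(gamma_fderiv s x).fderiv, Complex.exp_ofReal_mul_I_re, ← map_smul]
  congr 2
  rw [LinearIsometryEquiv.symm_apply_eq]
  ext v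
  simp [Complex.exp_ofReal_mul_I_re, Complex.exp_ofReal_mul_I_im]

lemma gammaIm_eq (C : X →L[ℝ] X) (DU : X → X) (s x : X) :
    steinGammaIm C DU (fun y => Complex.exp ((⟪s, y⟫ : ℂ) * Complex.I)) x
      = (Real.cos ⟪s, x⟫) • C s - Real.sin ⟪s, x⟫ • (x + C (DU x)) := by
  unfold steinGammaIm
  rw [(gamma_fderiv s x).fderiv, Complex.exp_ofReal_mul_I_im, ← map_smul]
  congr 2
  rw [LinearIsometryEquiv.symm_apply_eq]
  ext v
  simp [Complex.exp_ofReal_mul_I_re, Complex.exp_ofReal_mul_I_im]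

/-- The pointwise spectral integrand. -/
noncomputable def specG (C : X →L[ℝ] X) (b : X → X) (s x x' : X) : ℝ :=
  ⟪-(Real.sin ⟪s, x⟫) • C s - Real.cos ⟪s, x⟫ • b x,
    -(Real.sin ⟪s, x'⟫) • C s - Real.cos ⟪s, x'⟫ • b x'⟫ +
  ⟪(Real.cos ⟪s, x⟫) • C s - Real.sin ⟪s, x⟫ • b x,
    (Real.cos ⟪s, x'⟫) • C s - Real.sin ⟪s, x'⟫ • b x'⟫

lemma specG_eq (C : X →L[ℝ] X) (b : X → X) (s x x' : X) :
    specG C b s x x' = Real.cos ⟪x - x', s⟫ * ‖C s‖ ^ 2 + Real.sin ⟪x - x', s⟫ * ⟪C s, b x'⟫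
      - Real.sin ⟪x - x', s⟫ * ⟪C s, b x⟫ + Real.cos ⟪x - x', s⟫ * ⟪b x, b x'⟫ := by
  unfold specG
  simp only [inner_sub_left, inner_sub_right, inner_smul_left, inner_smul_right, Real.sin_sub,
    Real.cos_sub, real_inner_self_eq_norm_sq, real_inner_comm s, real_inner_comm (C s) (b x),
    conj_trivial]
  ring

lemma hv_eq [MeasurableSpace X] [BorelSpace X] [SecondCountableTopology X]
    (C : X →L[ℝ] X) (hCsa : IsSelfAdjoint C)
    (e : HilbertBasis ℕ ℝ X) (l : ℕ → ℝ) (hl : ∀ i, 0 < l i)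
    (hCe : ∀ i, C (e i) = l i • e i) (hltr : Summable l) (DU : X → X)
    (μ : Measure X) [IsFiniteMeasure μ]
    (hμ2 : Integrable (fun s => ‖s‖ ^ 2) μ)
    (k : X → X → ℝ)
    (hk : ∀ x y : X, (k x y : ℂ) = ∫ u, Complex.exp ((⟪x - y, u⟫ : ℂ) * Complex.I) ∂μ)
    (x x' : X) :
    steinKernelHv k C DU (fun i => e i) l x x' =
      ∫ s, specG C (fun x => x + C (DU x)) s x x' ∂μ := by
  have hadj : ∀ u v, ⟪C u, v⟫ = ⟪u, C v⟫ := fun u v =>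
    (ContinuousLinearMap.isSelfAdjoint_iff_isSymmetric.1 hCsa) u v
  have hμ1 : Integrable (fun s : X => ‖s‖) μ := by
    refine (hμ2.add (integrable_const (1 : ℝ))).mono' (by fun_prop) (Eventually.of_forall fun s => ?_)
    simp only [norm_norm, Pi.add_apply]
    nlinarith [sq_nonneg (‖s‖ - 1), norm_nonneg s]
  have hkc : ∀ x y, k x y = ∫ u, Real.cos ⟪x - y, u⟫ * 1 ∂μ := by
    intro x y
    have h := congrArg Complex.re (hk x y)
    rw [Complex.ofReal_re] at h
    have hint : Integrable (fun u : X => Complex.exp ((⟪x - y, u⟫ : ℂ) * Complex.I)) μ := by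
      refine (integrable_const (1 : ℝ)).mono' (Continuous.aestronglyMeasurable (by fun_prop))
        (Eventually.of_forall fun u => ?_)
      rw [Complex.norm_exp_ofReal_mul_I]
    rw [h, ← RCLike.re_eq_complex_re, ← integral_re hint]
    simp [Complex.exp_ofReal_mul_I_re]
  have hcosD := fun z => aux_hasFDerivAt μ Real.cos (fun t => -Real.sin t) Real.hasDerivAt_cos
    (by fun_prop) Real.abs_cos_le_one (fun t => by simpa using Real.abs_sin_le_one t)
    (fun _ => 1) (by fun_prop) (integrable_const _) (by simpa using hμ1) z
  have hin : ∀ v : X, Integrable (fun u : X => ⟪u, v⟫) μ := fun v => by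
    refine (hμ1.mul_const ‖v‖).mono' (by fun_prop) (Eventually.of_forall fun s => ?_)
    exact norm_inner_le_norm s v
  have hin2 : ∀ v : X, Integrable (fun u : X => |⟪u, v⟫| * ‖u‖) μ := fun v => by
    refine (hμ2.mul_const ‖v‖).mono' (by fun_prop) (Eventually.of_forall fun s => ?_)
    have := abs_real_inner_le_norm s v
    rw [norm_mul, norm_norm, Real.norm_eq_abs, abs_abs]
    nlinarith [norm_nonneg s]
  have hsinD := fun v z => aux_hasFDerivAt μ Real.sin Real.cos Real.hasDerivAt_sin
    (by fun_prop) Real.abs_sin_le_one Real.abs_cos_le_one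
    (fun u => ⟪u, v⟫) (by fun_prop) (hin v) (hin2 v) z
  -- derivatives of the kernel
  have hD1 : ∀ x y v, fderiv ℝ (fun x1 => k x1 y) x v = -∫ u, Real.sin ⟪x - y, u⟫ * ⟪u, v⟫ ∂μ := by
    intro x y v
    simp only [hkc]
    have h := (hcosD (x - y)).1.comp x ((hasFDerivAt_id x).sub_const y)
    have h' := h.fderiv
    simp only [Function.comp_def, id] at h'
    rw [h', ContinuousLinearMap.comp_id, (hcosD (x - y)).2, ← integral_neg]
    simp
  have hD2 : ∀ x y v, fderiv ℝ (fun y1 => k x y1) y v = ∫ u, Real.sin ⟪x - y, u⟫ * ⟪u, v⟫ ∂μ := by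
    intro x y v
    simp only [hkc]
    have h := (hcosD (x - y)).1.comp y ((hasFDerivAt_id y).const_sub x)
    have h' := h.fderiv
    simp only [Function.comp_def, id] at h'
    rw [h']
    simp only [ContinuousLinearMap.comp_neg, ContinuousLinearMap.comp_id,
      neg_apply]
    rw [(hcosD (x - y)).2, ← integral_neg]
    simp
  have hD12 : ∀ x y v, fderiv ℝ (fun y1 => fderiv ℝ (fun x1 => k x1 y1) x v) y v
      = ∫ u, Real.cos ⟪x - y, u⟫ * ⟪u, v⟫ * ⟪u, v⟫ ∂μ := by
    intro x y v
    simp only [hD1]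
    have h := ((hsinD v (x - y)).1.comp y ((hasFDerivAt_id y).const_sub x)).neg
    have h' := h.fderiv
    simp only [Function.comp_def, id, Pi.neg_def] at h'
    rw [h']
    simp only [ContinuousLinearMap.comp_neg, ContinuousLinearMap.comp_id,
      neg_apply, neg_neg]
    rw [(hsinD v (x - y)).2]
  -- integrability
  have hI0 : ∀ z : X, Integrable (fun u : X => Real.cos ⟪z, u⟫) μ := fun z => by
    refine (integrable_const (1 : ℝ)).mono' (by fun_prop) (Eventually.of_forall fun u => ?_)
    exact Real.abs_cos_le_one _
  have hI1 : ∀ z v : X, Integrable (fun u : X => Real.sin ⟪z, u⟫ * ⟪u, v⟫) μ := fun z v => by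
    refine (hin v).mono (by fun_prop) (Eventually.of_forall fun u => ?_)
    rw [norm_mul]
    exact mul_le_of_le_one_left (norm_nonneg _) (Real.abs_sin_le_one _)
  have hI2 : Integrable (fun u : X => Real.cos ⟪x - x', u⟫ * ‖C u‖ ^ 2) μ := by
    refine (hμ2.const_mul (‖C‖ ^ 2)).mono' (by fun_prop) (Eventually.of_forall fun u => ?_)
    rw [norm_mul, norm_pow, norm_norm, ← mul_pow]
    refine (mul_le_of_le_one_left (by positivity) (Real.abs_cos_le_one _)).trans ?_
    gcongr
    exact C.le_opNorm u
  -- the trace term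
  have hl2 : Summable (fun i => l i ^ 2) := by
    refine Summable.of_nonneg_of_le (fun i => sq_nonneg _) (fun i => ?_) (hltr.mul_left ‖C‖)
    have h1 := C.le_opNorm (e i)
    rw [hCe, norm_smul, e.orthonormal.1 i, mul_one, mul_one, Real.norm_eq_abs,
      abs_of_pos (hl i)] at h1
    nlinarith [hl i]
  have htr : (∑' i, l i ^ 2 *
      fderiv ℝ (fun y1 => fderiv ℝ (fun x1 => k x1 y1) x (e i)) x' (e i)) =
      ∫ u, Real.cos ⟪x - x', u⟫ * ‖C u‖ ^ 2 ∂μ := by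
    simp only [hD12, ← integral_const_mul]
    have hb : ∀ i (u : X), ‖l i ^ 2 * (Real.cos ⟪x - x', u⟫ * ⟪u, e i⟫ * ⟪u, e i⟫)‖
        ≤ l i ^ 2 * ‖u‖ ^ 2 := by
      intro i u
      rw [norm_mul, norm_pow, Real.norm_eq_abs, sq_abs, mul_assoc, norm_mul, norm_mul]
      gcongr
      have h1 := norm_inner_le_norm (𝕜 := ℝ) u (e i)
      rw [e.orthonormal.1 i, mul_one] at h1
      refine (mul_le_of_le_one_left (by positivity) (Real.abs_cos_le_one _)).trans ?_
      rw [sq]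
      gcongr
    have hFi : ∀ i, Integrable
        (fun u : X => l i ^ 2 * (Real.cos ⟪x - x', u⟫ * ⟪u, e i⟫ * ⟪u, e i⟫)) μ := fun i =>
      (hμ2.const_mul (l i ^ 2)).mono' (by fun_prop) (Eventually.of_forall (hb i))
    have hs := hasSum_integral_of_summable_integral_norm hFi (by
      refine Summable.of_nonneg_of_le (fun i => integral_nonneg fun u => norm_nonneg _)
        (fun i => ?_) (hl2.mul_right (∫ u, ‖u‖ ^ 2 ∂μ))
      rw [← integral_const_mul]
      exact integral_mono (hFi i).norm (hμ2.const_mul _) (hb i))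
    rw [hs.tsum_eq]
    congr 1
    ext u
    have h1 := e.hasSum_inner_mul_inner (C u) (C u)
    have h2 := h1.mul_left (Real.cos ⟪x - x', u⟫)
    rw [real_inner_self_eq_norm_sq] at h2
    rw [← h2.tsum_eq]
    congr 1
    ext i
    rw [← hadj (e i) u, hadj u (e i), hCe, inner_smul_left, inner_smul_right,
      real_inner_comm u (e i)]
    simp only [conj_trivial]
    ring
  unfold steinKernelHv
  rw [htr, hD1, hD2]
  simp only [specG_eq]
  rw [integral_add, integral_sub, integral_add hI2, integral_mul_const, hkc]
  · simp only [mul_one, hadj, map_add]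
    ring
  all_goals try simp only [hadj]
  · exact hI1 _ _
  · exact hI2.add (hI1 _ _)
  · exact hI1 _ _
  · exact (hI2.add (hI1 _ _)).sub (hI1 _ _)
  · exact (hI0 _).mul_const _

end helpers

/-- **Spectral representation of the vectorised kernel Stein discrepancy**
(Theorem 2, second part).  The squared norm in the complexification `X_ℂ` of the
`Q`-integral of `Γ(e^{i⟨s,·⟩})` is the sum of the squared norms of the integrals of its
real and imaginary parts. -/
theorem ksd_vectorised_spectral_representation
    {X : Type*} [NormedAddCommGroup X] [InnerProductSpace ℝ X] [CompleteSpace X]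
    [MeasurableSpace X] [BorelSpace X] [SecondCountableTopology X]
    -- the covariance operator and its eigendecomposition
    (C : X →L[ℝ] X) (hCsa : IsSelfAdjoint C)
    (e : HilbertBasis ℕ ℝ X) (l : ℕ → ℝ) (hl : ∀ i, 0 < l i)
    (hCe : ∀ i, C (e i) = l i • e i) (hltr : Summable l)
    -- the potential `U` and its gradient `DU`
    (U : X → ℝ) (DU : X → X)
    (hU : ∀ x, HasFDerivAt U ((InnerProductSpace.toDual ℝ X) (DU x) : X →L[ℝ] ℝ) x)
    -- the candidate measure `Q` and its moment conditions
    (Q : Measure X) [IsProbabilityMeasure Q]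
    (hQ2 : Integrable (fun x => ‖x‖ ^ 2) Q)
    (hQU : Integrable (fun x => ‖C (DU x)‖) Q)
    -- the spectral measure `μ` and the kernel `k`
    (μ : Measure X) [IsFiniteMeasure μ]
    (hμsymm : Measure.map (fun u => -u) μ = μ)
    (hμ2 : Integrable (fun s => ‖s‖ ^ 2) μ)
    (k : X → X → ℝ)
    (hk : ∀ x y : X, (k x y : ℂ) = ∫ u, Complex.exp ((⟪x - y, u⟫ : ℂ) * Complex.I) ∂μ) :
    Integrable (fun p : X × X =>
        steinKernelHv k C DU (fun i => e i) l p.1 p.2) (Q.prod Q) ∧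
    Integrable (fun s : X =>
        ‖∫ x, steinGammaRe C DU (fun y => Complex.exp ((⟪s, y⟫ : ℂ) * Complex.I)) x ∂Q‖ ^ 2
        + ‖∫ x, steinGammaIm C DU (fun y => Complex.exp ((⟪s, y⟫ : ℂ) * Complex.I)) x ∂Q‖ ^ 2) μ ∧
    ∫ x, ∫ x', steinKernelHv k C DU (fun i => e i) l x x' ∂Q ∂Q
      = ∫ s,
          (‖∫ x, steinGammaRe C DU (fun y => Complex.exp ((⟪s, y⟫ : ℂ) * Complex.I)) x ∂Q‖ ^ 2
          + ‖∫ x, steinGammaIm C DU (fun y => Complex.exp ((⟪s, y⟫ : ℂ) * Complex.I)) x ∂Q‖ ^ 2)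
        ∂μ := by
  have hDU : Measurable DU := by
    have h : DU = fun x => (InnerProductSpace.toDual ℝ X).symm (fderiv ℝ U x) := by
      ext1 x
      rw [(hU x).fderiv]
      exact ((InnerProductSpace.toDual ℝ X).symm_apply_apply (DU x)).symm
    rw [h]
    exact (InnerProductSpace.toDual ℝ X).symm.continuous.measurable.comp (measurable_fderiv ℝ U)
  set b : X → X := fun x => x + C (DU x) with hbdef
  have hbm : Measurable b := by
    have := C.measurable.comp hDU
    exact measurable_id.add this
  have hCDi : Integrable (fun x => C (DU x)) Q :=
    (integrable_norm_iff (C.measurable.comp hDU).aestronglyMeasurable).1 hQU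
  have hidi : Integrable (fun x : X => x) Q := by
    refine (hQ2.add (integrable_const (1 : ℝ))).mono' (by fun_prop)
      (Eventually.of_forall fun s => ?_)
    simp only [Pi.add_apply]
    nlinarith [sq_nonneg (‖s‖ - 1), norm_nonneg s]
  have hbi : Integrable b Q := hidi.add hCDi
  have hC2 : Integrable (fun s => ‖C s‖ ^ 2) μ := by
    refine (hμ2.const_mul (‖C‖ ^ 2)).mono' (by fun_prop) (Eventually.of_forall fun u => ?_)
    rw [norm_pow, norm_norm, ← mul_pow]
    gcongr
    exact C.le_opNorm u
  have hC1 : Integrable (fun s => ‖C s‖) μ := by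
    refine (hC2.add (integrable_const (1 : ℝ))).mono' (by fun_prop)
      (Eventually.of_forall fun s => ?_)
    simp only [Pi.add_apply, norm_norm]
    nlinarith [sq_nonneg (‖C s‖ - 1), norm_nonneg (C s)]
  have hbound : ∀ s x x', ‖specG C b s x x'‖ ≤
      ‖C s‖ ^ 2 + ‖C s‖ * ‖b x'‖ + ‖C s‖ * ‖b x‖ + ‖b x‖ * ‖b x'‖ := by
    intro s x x'
    rw [specG_eq]
    have h1 : ∀ c a d : ℝ, |c| ≤ 1 → ‖a‖ ≤ d → ‖c * a‖ ≤ d := by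
      intro c a d hc ha
      rw [norm_mul]
      exact (mul_le_of_le_one_left (norm_nonneg _) hc).trans ha
    refine (norm_add_le _ _).trans (add_le_add ((norm_sub_le _ _).trans
      (add_le_add ((norm_add_le _ _).trans (add_le_add ?_ ?_)) ?_)) ?_)
    · exact h1 _ _ _ (Real.abs_cos_le_one _) (by simp)
    · exact h1 _ _ _ (Real.abs_sin_le_one _) (norm_inner_le_norm _ _)
    · exact h1 _ _ _ (Real.abs_sin_le_one _) (norm_inner_le_norm _ _)
    · exact h1 _ _ _ (Real.abs_cos_le_one _) (norm_inner_le_norm _ _)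
  have hGm : Measurable (fun q : X × X × X => specG C b q.1 q.2.1 q.2.2) := by
    unfold specG
    fun_prop
  have hb1 : Integrable (fun p : X × X => ‖b p.1‖) (Q.prod Q) := hbi.norm.comp_fst Q
  have hb2 : Integrable (fun p : X × X => ‖b p.2‖) (Q.prod Q) := hbi.norm.comp_snd Q
  have hb12 : Integrable (fun p : X × X => ‖b p.1‖ * ‖b p.2‖) (Q.prod Q) :=
    hbi.norm.mul_prod hbi.norm
  have hF : Integrable (fun q : X × X × X => specG C b q.1 q.2.1 q.2.2) (μ.prod (Q.prod Q)) := by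
    refine ((((hC2.comp_fst (Q.prod Q)).add (hC1.mul_prod hb2)).add
      (hC1.mul_prod hb1)).add (hb12.comp_snd μ)).mono' hGm.aestronglyMeasurable
      (Eventually.of_forall fun q => ?_)
    exact hbound _ _ _
  have hFs : ∀ s, Integrable (fun p : X × X => specG C b s p.1 p.2) (Q.prod Q) := by
    intro s
    refine ((((integrable_const (‖C s‖ ^ 2)).add (hb2.const_mul ‖C s‖)).add
      (hb1.const_mul ‖C s‖)).add hb12).mono'
      (hGm.comp measurable_prodMk_left).aestronglyMeasurable
      (Eventually.of_forall fun q => ?_)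
    exact hbound _ _ _
  have hgen : ∀ (s : X) (c d : X → ℝ), Continuous c → Continuous d → (∀ t, |c t| ≤ 1) →
      (∀ t, |d t| ≤ 1) → Integrable (fun x => c x • C s - d x • b x) Q := by
    intro s c d hc hd hc1 hd1
    refine ((integrable_const ‖C s‖).add hbi.norm).mono' (by fun_prop)
      (Eventually.of_forall fun x => (norm_sub_le _ _).trans (add_le_add ?_ ?_))
    · rw [norm_smul]
      exact mul_le_of_le_one_left (norm_nonneg _) (hc1 _)
    · rw [norm_smul]
      exact mul_le_of_le_one_left (norm_nonneg _) (hd1 _)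
  have hRi : ∀ s : X, Integrable
      (fun x => -(Real.sin ⟪s, x⟫) • C s - Real.cos ⟪s, x⟫ • b x) Q := fun s =>
    hgen s _ _ (by fun_prop) (by fun_prop) (fun t => by simpa using Real.abs_sin_le_one _)
      (fun t => Real.abs_cos_le_one _)
  have hIi : ∀ s : X, Integrable
      (fun x => (Real.cos ⟪s, x⟫) • C s - Real.sin ⟪s, x⟫ • b x) Q := fun s =>
    hgen s _ _ (by fun_prop) (by fun_prop) (fun t => Real.abs_cos_le_one _)
      (fun t => Real.abs_sin_le_one _)
  have hspec : ∀ s : X,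
      ‖∫ x, steinGammaRe C DU (fun y => Complex.exp ((⟪s, y⟫ : ℂ) * Complex.I)) x ∂Q‖ ^ 2
      + ‖∫ x, steinGammaIm C DU (fun y => Complex.exp ((⟪s, y⟫ : ℂ) * Complex.I)) x ∂Q‖ ^ 2
      = ∫ p : X × X, specG C b s p.1 p.2 ∂(Q.prod Q) := by
    intro s
    simp only [gammaRe_eq, gammaIm_eq]
    rw [integral_prod _ (hFs s)]
    simp only [specG]
    have hinner : ∀ x, ∫ x', (⟪-(Real.sin ⟪s, x⟫) • C s - Real.cos ⟪s, x⟫ • b x,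
          -(Real.sin ⟪s, x'⟫) • C s - Real.cos ⟪s, x'⟫ • b x'⟫ +
        ⟪(Real.cos ⟪s, x⟫) • C s - Real.sin ⟪s, x⟫ • b x,
          (Real.cos ⟪s, x'⟫) • C s - Real.sin ⟪s, x'⟫ • b x'⟫) ∂Q
        = ⟪∫ x', (-(Real.sin ⟪s, x'⟫) • C s - Real.cos ⟪s, x'⟫ • b x') ∂Q,
            -(Real.sin ⟪s, x⟫) • C s - Real.cos ⟪s, x⟫ • b x⟫ +
          ⟪∫ x', ((Real.cos ⟪s, x'⟫) • C s - Real.sin ⟪s, x'⟫ • b x') ∂Q,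
            (Real.cos ⟪s, x⟫) • C s - Real.sin ⟪s, x⟫ • b x⟫ := by
      intro x
      rw [integral_add ((hRi s).const_inner _) ((hIi s).const_inner _), integral_inner (hRi s),
        integral_inner (hIi s), real_inner_comm, add_comm, real_inner_comm, add_comm]
    simp only [hinner]
    rw [integral_add ((hRi s).const_inner _) ((hIi s).const_inner _), integral_inner (hRi s),
        integral_inner (hIi s), real_inner_self_eq_norm_sq, real_inner_self_eq_norm_sq]
  have hh : ∀ x x', steinKernelHv k C DU (fun i => e i) l x x' = ∫ s, specG C b s x x' ∂μ :=
    hv_eq C hCsa e l hl hCe hltr DU μ hμ2 k hk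
  have hHi : Integrable (fun p : X × X =>
      steinKernelHv k C DU (fun i => e i) l p.1 p.2) (Q.prod Q) := by
    simp only [hh]
    exact hF.integral_prod_right
  refine ⟨hHi, ?_, ?_⟩
  · simp only [hspec]
    exact hF.integral_prod_left
  · rw [← integral_prod (fun p : X × X => steinKernelHv k C DU (fun i => e i) l p.1 p.2) hHi]
    simp only [hspec, hh]
    exact (integral_integral_swap hF).symm
end

section
/- Separation property of the vectorised kernel Stein discrepancy (Theorem 3, second part): assume additionally that ∫ ‖s‖² dμ(s) < ∞ and that μ has full topological support, i.e. μ(B) > 0 for every nonempty open set B ⊆ X. Then ∫_X ∫_X h_v(x,x') dQ(x) dQ(x') = 0 if and only if Q = P. -/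
open MeasureTheory ProbabilityTheory Complex Filter
open scoped RealInnerProductSpace
/-- Uniqueness for the linear scalar ODE `R' = α R` in integrated form, with a coefficient `α`
which is only assumed to be a derivative. -/
lemma ode_unique (R W α : ℝ → ℝ) (hW : ∀ t, HasDerivAt W (-α t) t)
    (hintegr : ∀ a b, IntervalIntegrable (fun t => α t * R t) volume a b)
    (hR : ∀ a b, R b - R a = ∫ t in a..b, α t * R t) :
    ∃ c : ℝ, ∀ t, R t = c * Real.exp (-W t) := by
  by_cases h0 : ∀ t, R t = 0
  · exact ⟨0, by simpa using h0⟩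
  push Not at h0
  obtain ⟨t0, ht0⟩ := h0
  have hRc : Continuous R := by
    have h1 : Continuous (fun b => ∫ t in (0:ℝ)..b, α t * R t) :=
      intervalIntegral.continuous_primitive hintegr 0
    have h2 : R = fun b => R 0 + ∫ t in (0:ℝ)..b, α t * R t := by
      funext b; rw [← hR]; ring
    rw [h2]; exact continuous_const.add h1
  have hWc : Continuous W := continuous_iff_continuousAt.2 fun t => (hW t).continuousAt
  have hαm : Measurable α := by
    have : α = fun t => - deriv W t := by
      funext t; rw [(hW t).deriv]; ring
    rw [this]; exact (measurable_deriv W).neg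
  set c := R t0 * Real.exp (W t0) with hc
  have hc0 : c ≠ 0 := mul_ne_zero ht0 (Real.exp_ne_zero _)
  refine ⟨c, ?_⟩
  let S : Set ℝ := {t | R t = c * Real.exp (-W t)}
  have hSclosed : IsClosed S := isClosed_eq hRc (by fun_prop)
  have hSopen : IsOpen S := by
    rw [Metric.isOpen_iff]
    intro t ht
    have htR : R t ≠ 0 := by
      have : R t = c * Real.exp (-W t) := ht
      rw [this]; exact mul_ne_zero hc0 (Real.exp_ne_zero _)
    -- neighbourhood where R ≠ 0
    obtain ⟨ε, hε, hεR⟩ := Metric.eventually_nhds_iff.1 (hRc.continuousAt.eventually_ne htR)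
    have hαint : IntegrableOn α (Set.Icc (t - ε/2) (t + ε/2)) volume := by
      have h1 : IntegrableOn (fun s => α s * R s) (Set.Icc (t - ε/2) (t + ε/2)) volume := by
        have := hintegr (t - ε/2) (t + ε/2)
        rwa [intervalIntegrable_iff_integrableOn_Icc_of_le (by linarith)] at this
      have h2 : ContinuousOn (fun s => (R s)⁻¹) (Set.Icc (t - ε/2) (t + ε/2)) := by
        apply ContinuousOn.inv₀ hRc.continuousOn
        intro s hs
        apply hεR
        rw [Real.dist_eq, abs_lt]
        constructor <;> linarith [hs.1, hs.2]
      have h3 := h1.mul_continuousOn h2 isCompact_Icc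
      refine h3.congr_fun ?_ measurableSet_Icc
      intro s hs
      have : R s ≠ 0 := by
        apply hεR
        rw [Real.dist_eq, abs_lt]
        constructor <;> linarith [hs.1, hs.2]
      simp only; field_simp
    have hαii : ∀ a ∈ Set.Icc (t - ε/2) (t + ε/2), ∀ b ∈ Set.Icc (t - ε/2) (t + ε/2),
        IntervalIntegrable α volume a b := by
      intro a ha b hb
      rw [intervalIntegrable_iff]
      exact hαint.mono_set (Set.uIoc_subset_uIcc.trans (Set.uIcc_subset_Icc ha hb))
    -- smallness of the integral of |α|
    let g : ℝ → ℝ := (Set.Icc (t - ε/2) (t + ε/2)).indicator (fun s => |α s|)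
    have hg : Integrable g := (integrable_indicator_iff measurableSet_Icc).2 hαint.abs
    have hGc : Continuous (fun b => ∫ s in t..b, g s) :=
      intervalIntegral.continuous_primitive (fun a b => hg.intervalIntegrable) t
    have hG0 : (fun b => ∫ s in t..b, g s) t = 0 := by simp
    obtain ⟨δ, hδ, hδG⟩ := Metric.continuousAt_iff.1 (hGc.continuousAt (x := t)) (1/2) (by norm_num)
    let η := min (δ/2) (ε/2)
    have hη : 0 < η := lt_min (by linarith) (by linarith)
    have hηδ : η ≤ δ/2 := min_le_left _ _
    have hηε : η ≤ ε/2 := min_le_right _ _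
    let D : ℝ → ℝ := fun s => R s - c * Real.exp (-W s)
    have hDc : Continuous D := by fun_prop
    have hDt : D t = 0 := by
      have : R t = c * Real.exp (-W t) := ht
      simp [D, this]
    have hDeq : ∀ r ∈ Set.Icc (t - η) (t + η), D r = ∫ s in t..r, α s * D s := by
      intro r hr
      have hti : t ∈ Set.Icc (t - ε/2) (t + ε/2) := ⟨by linarith, by linarith⟩
      have hri : r ∈ Set.Icc (t - ε/2) (t + ε/2) :=
        ⟨by linarith [hr.1], by linarith [hr.2]⟩
      have hii := hαii t hti r hri
      have e1 : IntervalIntegrable (fun s => α s * (c * Real.exp (-W s))) volume t r :=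
        hii.mul_continuousOn (by fun_prop)
      have e2 : ∫ s in t..r, α s * (c * Real.exp (-W s))
          = c * Real.exp (-W r) - c * Real.exp (-W t) := by
        apply intervalIntegral.integral_eq_sub_of_hasDerivAt _ e1
        intro s _
        have := ((hW s).neg.exp).const_mul c
        exact this.congr_deriv (by simp only [Pi.neg_apply, neg_neg]; ring)
      have e3 : ∫ s in t..r, α s * D s
          = (∫ s in t..r, α s * R s) - ∫ s in t..r, α s * (c * Real.exp (-W s)) := by
        rw [← intervalIntegral.integral_sub (hintegr t r) e1]
        congr 1; funext s; simp only [D]; ring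
      rw [e3, e2, ← hR]
      have : R t = c * Real.exp (-W t) := ht
      simp only [D]; linarith
    have htη : (Set.Icc (t - η) (t + η)).Nonempty := ⟨t, by linarith, by linarith⟩
    obtain ⟨m, hm, hmax⟩ := isCompact_Icc.exists_isMaxOn htη (hDc.abs.continuousOn)
    have hbound : |D m| ≤ |D m| * (1/2) := by
      have hm' := hDeq m hm
      have hsub : Set.uIoc t m ⊆ Set.Icc (t - η) (t + η) :=
        Set.uIoc_subset_uIcc.trans (Set.uIcc_subset_Icc ⟨by linarith, by linarith⟩ hm)
      have h1 : |∫ s in t..m, α s * D s| ≤ abs (∫ s in t..m, g s * abs (D m)) := by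
        have := intervalIntegral.norm_integral_le_abs_of_norm_le (μ := volume) (a := t) (b := m)
          (f := fun s => α s * D s) (g := fun s => g s * abs (D m)) ?_ ?_
        · simpa using this
        · refine (ae_restrict_mem measurableSet_uIoc).mono ?_
          intro s hs
          have hs' := hsub hs
          have hsε : s ∈ Set.Icc (t - ε/2) (t + ε/2) :=
            ⟨by linarith [hs'.1], by linarith [hs'.2]⟩
          simp only [g, Set.indicator_of_mem hsε, Real.norm_eq_abs, abs_mul]
          exact mul_le_mul_of_nonneg_left (hmax hs') (abs_nonneg _)
        · exact (hg.intervalIntegrable).mul_const _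
      have h2 : dist m t < δ := by
        rw [Real.dist_eq, abs_lt]; constructor <;> linarith [hm.1, hm.2]
      have h3 := hδG h2
      rw [intervalIntegral.integral_same, Real.dist_eq, sub_zero] at h3
      rw [intervalIntegral.integral_mul_const, abs_mul, abs_abs] at h1
      calc |D m| = |∫ s in t..m, α s * D s| := by rw [← hm']
        _ ≤ _ := h1
        _ ≤ (1/2) * |D m| := mul_le_mul_of_nonneg_right h3.le (abs_nonneg _)
        _ = _ := by ring
    have hDm : |D m| = 0 := le_antisymm (by linarith) (abs_nonneg _)
    refine ⟨η, hη, ?_⟩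
    intro r hr
    rw [Metric.mem_ball, Real.dist_eq, abs_lt] at hr
    have : |D r| ≤ |D m| := hmax ⟨by linarith [hr.1], by linarith [hr.2]⟩
    rw [hDm] at this
    have h4 : D r = 0 := abs_eq_zero.1 (le_antisymm this (abs_nonneg _))
    simp only [D] at h4
    show R r = c * Real.exp (-W r)
    linarith
  have hSne : S.Nonempty := ⟨t0, by
    show R t0 = R t0 * Real.exp (W t0) * Real.exp (-W t0)
    rw [mul_assoc, ← Real.exp_add]; simp⟩
  have hSu : S = Set.univ := IsClopen.eq_univ ⟨hSclosed, hSopen⟩ hSne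
  intro t
  have : t ∈ S := hSu ▸ Set.mem_univ t
  exact this

/-- A density on the line satisfying the (integrated) equation `ρ' = -V' ρ` is a multiple
of `exp (-V)`. -/
lemma line_density (ρ : ℝ → ENNReal) (hρm : Measurable ρ) (V β : ℝ → ℝ)
    (hV : ∀ t, HasDerivAt V (β t) t)
    (hfin : ∫⁻ t, ENNReal.ofReal (abs (1 - β t)) * ρ t ≠ ⊤)
    (hρfin : ∀ᵐ t, ρ t ≠ ⊤)
    (heq : ∀ᵐ s, ρ s + ∫⁻ t in Set.Iic s, ENNReal.ofReal (Real.exp (t - s)) *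
        (ENNReal.ofReal (-(1 - β t)) * ρ t)
      = ∫⁻ t in Set.Iic s, ENNReal.ofReal (Real.exp (t - s)) *
        (ENNReal.ofReal (1 - β t) * ρ t)) :
    ∃ c : ENNReal, ∀ᵐ t, ENNReal.ofReal (Real.exp (V t)) * ρ t = c := by
  set r : ℝ → ℝ := fun t => (ρ t).toReal with hr
  have hrm : Measurable r := hρm.ennreal_toReal
  have hβm : Measurable β := by
    have : β = fun t => deriv V t := by
      funext t; rw [(hV t).deriv]
    rw [this]; exact measurable_deriv V
  let α : ℝ → ℝ := fun t => 1 - β t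
  have hαm : Measurable α := measurable_const.sub hβm
  have hρr : ∀ᵐ t, ρ t = ENNReal.ofReal (r t) := by
    filter_upwards [hρfin] with t ht
    rw [hr, ENNReal.ofReal_toReal ht]
  have hαr : Integrable (fun t => α t * r t) := by
    refine ⟨(hαm.mul hrm).aestronglyMeasurable, ?_⟩
    rw [hasFiniteIntegral_iff_norm]
    refine lt_of_le_of_lt (le_of_eq ?_) (lt_top_iff_ne_top.2 hfin)
    apply lintegral_congr_ae
    filter_upwards [hρr] with t ht
    rw [ht, ← ENNReal.ofReal_mul (abs_nonneg _), Real.norm_eq_abs, abs_mul,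
      abs_of_nonneg (a := r t) ENNReal.toReal_nonneg]
  have hexpI : ∀ s a, IntegrableOn (fun t => Real.exp (t - a) * (α t * r t)) (Set.Iic s) := by
    intro s a
    refine Integrable.bdd_mul (c := Real.exp (s - a)) hαr.integrableOn (by fun_prop) ?_
    refine (ae_restrict_mem measurableSet_Iic).mono fun t ht => ?_
    rw [Real.norm_eq_abs, abs_of_pos (Real.exp_pos _)]
    exact Real.exp_le_exp.2 (by linarith [Set.mem_Iic.1 ht])
  have hF : ∀ s, IntegrableOn (fun t => Real.exp t * (α t * r t)) (Set.Iic s) := by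
    intro s; simpa using hexpI s 0
  let R : ℝ → ℝ := fun s => ∫ t in Set.Iic s, Real.exp t * (α t * r t)
  have hrR : ∀ᵐ s, r s = Real.exp (-s) * R s := by
    filter_upwards [heq, hρr] with s hs hρs
    have e1 : Real.exp (-s) * R s = ∫ t in Set.Iic s, Real.exp (t - s) * (α t * r t) := by
      simp only [R]
      rw [← integral_const_mul]
      congr 1; funext t
      rw [← mul_assoc, ← Real.exp_add]; ring_nf
    have e2 := integral_eq_lintegral_pos_part_sub_lintegral_neg_part (hexpI s s)
    have hp : ∫⁻ t in Set.Iic s, ENNReal.ofReal (Real.exp (t - s) * (α t * r t))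
        = ∫⁻ t in Set.Iic s, ENNReal.ofReal (Real.exp (t - s)) *
        (ENNReal.ofReal (1 - β t) * ρ t) := by
      apply lintegral_congr_ae
      filter_upwards [ae_restrict_of_ae hρr] with t ht
      rw [ht, ← ENNReal.ofReal_mul' ENNReal.toReal_nonneg,
        ← ENNReal.ofReal_mul (Real.exp_pos _).le]
    have hn : ∫⁻ t in Set.Iic s, ENNReal.ofReal (-(Real.exp (t - s) * (α t * r t)))
        = ∫⁻ t in Set.Iic s, ENNReal.ofReal (Real.exp (t - s)) *
        (ENNReal.ofReal (-(1 - β t)) * ρ t) := by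
      apply lintegral_congr_ae
      filter_upwards [ae_restrict_of_ae hρr] with t ht
      rw [ht, ← ENNReal.ofReal_mul' ENNReal.toReal_nonneg,
        ← ENNReal.ofReal_mul (Real.exp_pos _).le]
      congr 1; simp only [α]; ring
    have hnfin : ∫⁻ t in Set.Iic s, ENNReal.ofReal (Real.exp (t - s)) *
        (ENNReal.ofReal (-(1 - β t)) * ρ t) ≠ ⊤ := by
      rw [← hn]
      exact ((hexpI s s).neg).lintegral_lt_top.ne
    rw [e1, e2, hp, hn, ← hs, ENNReal.toReal_add (by rw [hρs]; exact ENNReal.ofReal_ne_top) hnfin]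
    simp [hr]
  have hFR : ∀ᵐ t, Real.exp t * (α t * r t) = α t * R t := by
    filter_upwards [hrR] with t ht
    rw [ht]
    have : Real.exp t * Real.exp (-t) = 1 := by rw [← Real.exp_add]; simp
    linear_combination (α t * R t) * this
  have hFii : ∀ a b, IntervalIntegrable (fun t => Real.exp t * (α t * r t)) volume a b := by
    intro a b
    rw [intervalIntegrable_iff]
    exact (hF (max a b)).mono_set fun x hx => hx.2
  have key := ode_unique R (fun t => V t - t) α
    (fun t => ((hV t).sub (hasDerivAt_id t)).congr_deriv (by simp [α]))
    (fun a b => (hFii a b).congr_ae (ae_restrict_of_ae hFR)) (by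
      intro a b
      rw [intervalIntegral.integral_Iic_sub_Iic (hF a) (hF b)]
      exact intervalIntegral.integral_congr_ae (hFR.mono fun x hx _ => hx))
  obtain ⟨c, hc⟩ := key
  refine ⟨ENNReal.ofReal c, ?_⟩
  filter_upwards [hrR, hρr] with t h1 h2
  rw [h2, ← ENNReal.ofReal_mul (Real.exp_pos _).le, h1, hc]
  congr 1
  have : Real.exp (V t) * (Real.exp (-t) * Real.exp (-(V t - t))) = 1 := by
    rw [← Real.exp_add, ← Real.exp_add]; simp; ring
  linear_combination c * this

/-- The density of the standard exponential distribution. -/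
noncomputable def expKer (r : ℝ) : ENNReal :=
  (Set.Ici (0:ℝ)).indicator (fun r => ENNReal.ofReal (Real.exp (-r))) r

lemma measurable_expKer : Measurable expKer := by
  unfold expKer
  exact Measurable.indicator (by fun_prop) measurableSet_Ici

lemma expKer_conv (F : ℝ → ENNReal) (s : ℝ) :
    ∫⁻ t, expKer (s - t) * F t
      = ∫⁻ t in Set.Iic s, ENNReal.ofReal (Real.exp (t - s)) * F t := by
  rw [← lintegral_indicator measurableSet_Iic]
  congr 1; funext t
  by_cases h : t ≤ s
  · rw [Set.indicator_of_mem (Set.mem_Iic.2 h), expKer,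
      Set.indicator_of_mem (by simpa using h)]
    congr 3; ring
  · rw [Set.indicator_of_notMem (by simpa using h), expKer,
      Set.indicator_of_notMem (by simpa using h), zero_mul]

lemma prod_density {Z : Type*} [MeasurableSpace Z] (Q' : Measure (Z × ℝ)) [IsFiniteMeasure Q']
    (V β : Z × ℝ → ℝ) (hVm : Measurable V) (hβm : Measurable β)
    (hV : ∀ z t, HasDerivAt (fun t => V (z, t)) (β (z, t)) t)
    (hfin : ∫⁻ p, ENNReal.ofReal (abs (1 - β p)) ∂Q' ≠ ⊤)
    (heq : ∀ f : Z × ℝ → ENNReal, Measurable f →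
      ∫⁻ p, f p ∂Q' + ∫⁻ p, ENNReal.ofReal (-(1 - β p)) * (∫⁻ r, expKer r * f (p.1, p.2 + r)) ∂Q'
      = ∫⁻ p, ENNReal.ofReal (1 - β p) * (∫⁻ r, expKer r * f (p.1, p.2 + r)) ∂Q') :
    ∃ c : Z → ENNReal, Measurable c ∧ ∀ f : Z × ℝ → ENNReal, Measurable f →
      ∫⁻ p, f p * ENNReal.ofReal (Real.exp (V p)) ∂Q'
        = ∫⁻ z, c z * (∫⁻ t, f (z, t)) ∂Q'.fst := by
  set σ : Measure (Z × ℝ) := Q'.fst.prod volume with hσ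
  have hac : Q' ≪ σ := by
    refine Measure.AbsolutelyContinuous.mk fun A hA hA0 => ?_
    have h1 := heq (A.indicator 1) (measurable_one.indicator hA)
    rw [lintegral_indicator_one hA] at h1
    have h2 : ∫⁻ p, ENNReal.ofReal (1 - β p) *
        (∫⁻ r, expKer r * A.indicator 1 (p.1, p.2 + r)) ∂Q' = 0 := by
      rw [hσ, Measure.measure_prod_null hA] at hA0
      have h3 : ∀ᵐ p ∂Q', (volume : Measure ℝ) (Prod.mk p.1 ⁻¹' A) = 0 :=
        ae_of_ae_map (f := Prod.fst) measurable_fst.aemeasurable hA0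
      rw [← lintegral_zero (μ := Q')]
      apply lintegral_congr_ae
      filter_upwards [h3] with p hp
      have h4 : ∫⁻ r, expKer r * A.indicator 1 (p.1, p.2 + r) = 0 := by
        rw [← lintegral_zero (μ := (volume : Measure ℝ))]
        apply lintegral_congr_ae
        have h5 : (volume : Measure ℝ) ((fun r => p.2 + r) ⁻¹' (Prod.mk p.1 ⁻¹' A)) = 0 := by
          rw [measure_preimage_add]; exact hp
        have h6 : ∀ᵐ r : ℝ, r ∉ ((fun r => p.2 + r) ⁻¹' (Prod.mk p.1 ⁻¹' A)) :=
          measure_eq_zero_iff_ae_notMem.1 h5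
        filter_upwards [h6] with r hr
        rw [Set.indicator_of_notMem (by simpa using hr), mul_zero]
      rw [h4, mul_zero]
    rw [h2] at h1
    exact (add_eq_zero.1 h1).1
  set ρ := Q'.rnDeriv σ with hρ
  have hρm : Measurable ρ := Measure.measurable_rnDeriv _ _
  have hQ' : σ.withDensity ρ = Q' := Measure.withDensity_rnDeriv_eq _ _ hac
  have hintegr : ∀ f : Z × ℝ → ENNReal, Measurable f → ∫⁻ p, f p ∂Q' = ∫⁻ p, f p * ρ p ∂σ := by
    intro f hf
    conv_lhs => rw [← hQ', lintegral_withDensity_eq_lintegral_mul _ hρm hf]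
    simp only [Pi.mul_apply, mul_comm]
  have hkm := measurable_expKer
  let G : (Z × ℝ → ENNReal) → Z × ℝ → ENNReal := fun g q =>
    ∫⁻ t, expKer (q.2 - t) * (g (q.1, t) * ρ (q.1, t))
  have hGm : ∀ g, Measurable g → Measurable (G g) := by
    intro g hg
    apply Measurable.lintegral_prod_right' (f := fun x : (Z × ℝ) × ℝ =>
      expKer (x.1.2 - x.2) * (g (x.1.1, x.2) * ρ (x.1.1, x.2)))
    fun_prop
  have hconv : ∀ g f : Z × ℝ → ENNReal, Measurable g → Measurable f →
      ∫⁻ p, g p * (∫⁻ r, expKer r * f (p.1, p.2 + r)) ∂Q' = ∫⁻ q, f q * G g q ∂σ := by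
    intro g f hg hf
    have hm1 : Measurable fun p : Z × ℝ => ∫⁻ r, expKer r * f (p.1, p.2 + r) := by
      apply Measurable.lintegral_prod_right' (f := fun x : (Z × ℝ) × ℝ =>
        expKer x.2 * f (x.1.1, x.1.2 + x.2))
      fun_prop
    rw [hintegr (fun p => g p * (∫⁻ r, expKer r * f (p.1, p.2 + r))) (by fun_prop), hσ, lintegral_prod _ (by fun_prop),
      lintegral_prod _ (by have := hGm g hg; fun_prop)]
    congr 1; funext z
    have e1 : ∀ t, g (z, t) * (∫⁻ r, expKer r * f (z, t + r)) * ρ (z, t)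
        = ∫⁻ s, f (z, s) * (expKer (s - t) * (g (z, t) * ρ (z, t))) := by
      intro t
      have := lintegral_add_left_eq_self (μ := (volume : Measure ℝ))
        (fun s => expKer (s - t) * f (z, s)) t
      simp only [add_sub_cancel_left] at this
      rw [this, ← lintegral_const_mul _ (by fun_prop), ← lintegral_mul_const _ (by fun_prop)]
      congr 1; funext s; ring
    simp only [e1]
    rw [lintegral_lintegral_swap (by fun_prop)]
    congr 1; funext s
    rw [lintegral_const_mul _ (by fun_prop)]
  have hmain : ∀ᵐ q ∂σ, ρ q + G (fun p => ENNReal.ofReal (-(1 - β p))) q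
      = G (fun p => ENNReal.ofReal (1 - β p)) q := by
    have m1 := hGm (fun p => ENNReal.ofReal (-(1 - β p))) (by fun_prop)
    have m2 := hGm (fun p => ENNReal.ofReal (1 - β p)) (by fun_prop)
    apply ae_eq_of_forall_setLIntegral_eq_of_sigmaFinite (hρm.add m1) m2
    intro A hA _
    have hi : Measurable (A.indicator (1 : Z × ℝ → ENNReal)) := measurable_one.indicator hA
    have h1 := heq (A.indicator 1) hi
    rw [hintegr _ hi, hconv _ _ (by fun_prop) hi, hconv _ _ (by fun_prop) hi,
      ← lintegral_add_left (by fun_prop)] at h1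
    rw [← lintegral_indicator hA, ← lintegral_indicator hA]
    convert h1 using 2
    · funext q
      by_cases hq : q ∈ A <;> simp [hq]
    · funext q
      by_cases hq : q ∈ A <;> simp [hq]
  have hρt : ∀ᵐ q ∂σ, ρ q ≠ ⊤ := (Measure.rnDeriv_lt_top Q' σ).mono fun q h => h.ne
  have hf2 : ∀ᵐ z ∂Q'.fst, ∫⁻ t, ENNReal.ofReal (abs (1 - β (z, t))) * ρ (z, t) ≠ ⊤ := by
    rw [hintegr _ (by fun_prop), hσ, lintegral_prod _ (by fun_prop)] at hfin
    refine (ae_lt_top ?_ hfin).mono fun z h => h.ne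
    exact Measurable.lintegral_prod_right' (f := fun x : Z × ℝ =>
      ENNReal.ofReal (abs (1 - β x)) * ρ x) (by fun_prop)
  have hline : ∀ᵐ z ∂Q'.fst, ∃ c : ENNReal, ∀ᵐ t,
      ENNReal.ofReal (Real.exp (V (z, t))) * ρ (z, t) = c := by
    filter_upwards [hf2, Measure.ae_ae_of_ae_prod hρt, Measure.ae_ae_of_ae_prod hmain]
      with z h1 h2 h3
    apply line_density (fun t => ρ (z, t)) (by fun_prop) _ _ (hV z) h1 h2
    filter_upwards [h3] with s hs
    rw [← expKer_conv, ← expKer_conv]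
    exact hs
  refine ⟨fun z => ∫⁻ t in Set.Icc (0:ℝ) 1, ENNReal.ofReal (Real.exp (V (z, t))) * ρ (z, t), ?_, ?_⟩
  · exact Measurable.lintegral_prod_right' (f := fun x : Z × ℝ =>
      ENNReal.ofReal (Real.exp (V x)) * ρ x) (by fun_prop)
  · intro f hf
    rw [hintegr _ (by fun_prop), hσ, lintegral_prod _ (by fun_prop)]
    apply lintegral_congr_ae
    filter_upwards [hline] with z hz
    obtain ⟨c, hc⟩ := hz
    have hcz : ∫⁻ t in Set.Icc (0:ℝ) 1, ENNReal.ofReal (Real.exp (V (z, t))) * ρ (z, t) = c := by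
      rw [lintegral_congr_ae (ae_restrict_of_ae hc)]
      simp
    rw [hcz, ← lintegral_const_mul _ (by fun_prop)]
    apply lintegral_congr_ae
    filter_upwards [hc] with t ht
    rw [mul_assoc, ht, mul_comm]

instance : IsFiniteMeasure ((volume : Measure ℝ).withDensity expKer) := by
  refine isFiniteMeasure_withDensity ?_
  unfold expKer
  rw [lintegral_indicator measurableSet_Ici]
  have h : IntegrableOn (fun r : ℝ => Real.exp (-r)) (Set.Ici 0) := by
    rw [integrableOn_Ici_iff_integrableOn_Ioi]
    exact integrableOn_exp_neg_Ioi 0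
  exact h.lintegral_lt_top.ne

lemma integral_expKer (a : ℝ) :
    ∫ r, cexp ((r * a : ℝ) * I) ∂((volume : Measure ℝ).withDensity expKer)
      = (1 - I * a)⁻¹ := by
  rw [integral_withDensity_eq_integral_toReal_smul measurable_expKer]
  · have h1 : ∀ r : ℝ, (expKer r).toReal • cexp ((r * a : ℝ) * I)
        = (Set.Ici (0:ℝ)).indicator (fun r : ℝ => cexp ((-1 + I * a) * r)) r := by
      intro r
      by_cases h : r ∈ Set.Ici (0:ℝ)
      · rw [expKer, Set.indicator_of_mem h, Set.indicator_of_mem h,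
          ENNReal.toReal_ofReal (Real.exp_pos _).le, Complex.real_smul, Complex.ofReal_exp,
          ← Complex.exp_add]
        congr 1; push_cast; ring
      · rw [expKer, Set.indicator_of_notMem h, Set.indicator_of_notMem h]; simp
    simp only [h1]
    rw [integral_indicator measurableSet_Ici, integral_Ici_eq_integral_Ioi,
      integral_exp_mul_complex_Ioi (by simp)]
    simp only [ofReal_zero, mul_zero, Complex.exp_zero]
    rw [neg_div, ← div_neg]
    rw [one_div]; congr 1; ring
  · refine Filter.Eventually.of_forall fun r => ?_
    unfold expKer
    by_cases h : r ∈ Set.Ici (0:ℝ)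
    · rw [Set.indicator_of_mem h]; exact ENNReal.ofReal_lt_top
    · rw [Set.indicator_of_notMem h]; exact ENNReal.zero_lt_top

section disint
variable {X : Type*} [NormedAddCommGroup X] [InnerProductSpace ℝ X] [CompleteSpace X]
    [MeasurableSpace X] [BorelSpace X] [SecondCountableTopology X]

/-- Identity between measures obtained from the Fourier form of the Stein equation. -/
lemma stein_conv (Q : Measure X) [IsFiniteMeasure Q] (e : X) (β : X → ℝ) (hβ : Measurable β)
    (hβi : Integrable β Q)
    (hchar : ∀ u, ∫ x, cexp (⟪x, u⟫ * I) * β x ∂Q = (I * ⟪e, u⟫) * charFun Q u) :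
    Q + (Q.withDensity fun x => ENNReal.ofReal (-(1 - β x))) ∗
        ((volume : Measure ℝ).withDensity expKer).map (fun r => r • e)
      = (Q.withDensity fun x => ENNReal.ofReal (1 - β x)) ∗
        ((volume : Measure ℝ).withDensity expKer).map (fun r => r • e) := by
  have hi : Integrable (fun x => 1 - β x) Q := (integrable_const 1).sub hβi
  have : IsFiniteMeasure (Q.withDensity fun x => ENNReal.ofReal (1 - β x)) :=
    isFiniteMeasure_withDensity_ofReal hi.2
  have : IsFiniteMeasure (Q.withDensity fun x => ENNReal.ofReal (-(1 - β x))) :=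
    isFiniteMeasure_withDensity_ofReal hi.neg.2
  apply Measure.ext_of_charFun
  funext u
  have hE : charFun (((volume : Measure ℝ).withDensity expKer).map (fun r => r • e)) u
      = (1 - I * ⟪e, u⟫)⁻¹ := by
    rw [charFun_apply, integral_map (by fun_prop) (by fun_prop), ← integral_expKer]
    simp only [real_inner_smul_left]
  have hne : (1 - I * ⟪e, u⟫ : ℂ) ≠ 0 := by
    intro h
    have := congrArg Complex.re h
    simp at this
  have hbd : ∀ x, ‖cexp (⟪x, u⟫ * I)‖ ≤ 1 := fun x => by
    rw [Complex.norm_exp_ofReal_mul_I]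
  have hM : ∀ g : X → ℝ, Measurable g →
      charFun (Q.withDensity fun x => ENNReal.ofReal (g x)) u
        = ∫ x, ((max (g x) 0 : ℝ) : ℂ) * cexp (⟪x, u⟫ * I) ∂Q := by
    intro g hg
    rw [charFun_apply, integral_withDensity_eq_integral_toReal_smul (by fun_prop)
      (Filter.Eventually.of_forall fun x => ENNReal.ofReal_lt_top)]
    simp only [ENNReal.toReal_ofReal', Complex.real_smul]
  have hbm : ∀ g : X → ℝ, Integrable g Q →
      Integrable (fun x => ((g x : ℝ) : ℂ) * cexp (⟪x, u⟫ * I)) Q := by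
    intro g hg
    exact (hg.ofReal (𝕜 := ℂ)).mul_bdd (c := 1) (by fun_prop) (Filter.Eventually.of_forall hbd)
  rw [charFun_apply (μ := Q + _), integral_add_measure]
  · rw [← charFun_apply, ← charFun_apply, charFun_conv, charFun_conv, hE, hM _ (by fun_prop),
      hM _ (by fun_prop)]
    have h1 : (∫ x, ((max (1 - β x) 0 : ℝ) : ℂ) * cexp (⟪x, u⟫ * I) ∂Q)
        - ∫ x, ((max (-(1 - β x)) 0 : ℝ) : ℂ) * cexp (⟪x, u⟫ * I) ∂Q
        = (1 - I * ⟪e, u⟫) * charFun Q u := by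
      rw [← integral_sub (hbm _ hi.pos_part) (hbm _ hi.neg_part)]
      have h2 : ∀ x, ((max (1 - β x) 0 : ℝ) : ℂ) * cexp (⟪x, u⟫ * I)
          - ((max (-(1 - β x)) 0 : ℝ) : ℂ) * cexp (⟪x, u⟫ * I)
          = cexp (⟪x, u⟫ * I) - cexp (⟪x, u⟫ * I) * β x := by
        intro x
        have h3 : (max (1 - β x) 0 : ℝ) - (max (-(1 - β x)) 0 : ℝ) = 1 - β x := by
          rcases le_total 0 (1 - β x) with h | h
          · rw [max_eq_left h, max_eq_right (by linarith)]; ring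
          · rw [max_eq_right h, max_eq_left (by linarith)]; ring
        rw [← sub_mul, ← Complex.ofReal_sub, h3]; push_cast; ring
      simp only [h2]
      rw [integral_sub, hchar, ← charFun_apply]
      · ring
      · simpa using hbm (fun _ => 1) (integrable_const 1)
      · simpa [mul_comm] using hbm _ hβi
    rw [sub_eq_iff_eq_add.1 h1, add_mul, mul_right_comm, mul_inv_cancel₀ hne, one_mul]
  · exact (integrable_const (1:ℂ)).mono (by fun_prop)
      (Filter.Eventually.of_forall fun x => by simp)
  · exact (integrable_const (1:ℂ)).mono (by fun_prop)
      (Filter.Eventually.of_forall fun x => by simp)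

lemma measurable_grad (U : X → ℝ) (DU : X → X)
    (hU : ∀ x, HasFDerivAt U ((InnerProductSpace.toDual ℝ X) (DU x) : X →L[ℝ] ℝ) x) :
    Measurable DU := by
  have : DU = fun x => (InnerProductSpace.toDual ℝ X).symm (fderiv ℝ U x) := by
    funext x; rw [(hU x).fderiv]; simp
  rw [this]
  exact (InnerProductSpace.toDual ℝ X).symm.continuous.measurable.comp (measurable_fderiv ℝ U)

lemma exists_factor (Q : Measure X) [IsFiniteMeasure Q] (U : X → ℝ) (DU : X → X)
    (hU : ∀ x, HasFDerivAt U ((InnerProductSpace.toDual ℝ X) (DU x) : X →L[ℝ] ℝ) x)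
    (e : X) (he : ‖e‖ = 1) (lam : NNReal) (hlam : lam ≠ 0)
    (hβi : Integrable (fun x => ⟪e, x⟫ / (lam : ℝ) + ⟪e, DU x⟫) Q)
    (hchar : ∀ u, ∫ x, cexp (⟪x, u⟫ * I) * ((⟪e, x⟫ / (lam : ℝ) + ⟪e, DU x⟫ : ℝ) : ℂ) ∂Q
      = (I * ⟪e, u⟫) * charFun Q u) :
    ∃ τ : Measure X, SFinite τ ∧ (∀ᵐ z ∂τ, ⟪e, z⟫ = 0) ∧
      Q.withDensity (fun x => ENNReal.ofReal (Real.exp (U x)))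
        = (τ.prod (gaussianReal 0 lam)).map (fun p => p.1 + p.2 • e) := by
  have hlam' : (lam : ℝ) ≠ 0 := by exact_mod_cast hlam
  have hDUm : Measurable DU := measurable_grad U DU hU
  have hUc : Continuous U := continuous_iff_continuousAt.2 fun x => (hU x).continuousAt
  have hUm : Measurable U := hUc.measurable
  have hee : ⟪e, e⟫ = 1 := by rw [real_inner_self_eq_norm_sq, he]; norm_num
  let β : X → ℝ := fun x => ⟪e, x⟫ / (lam : ℝ) + ⟪e, DU x⟫
  have hβm : Measurable β := by fun_prop
  have hconv := stein_conv Q e β hβm hβi hchar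
  let φ : X → X × ℝ := fun x => (x - ⟪e, x⟫ • e, ⟪e, x⟫)
  have hφm : Measurable φ := by fun_prop
  let ι : X × ℝ → X := fun p => p.1 + p.2 • e
  have hιm : Measurable ι := by fun_prop
  have hιφ : ∀ x, ι (φ x) = x := fun x => by simp [ι, φ]
  have hφadd : ∀ x (r : ℝ), φ (x + r • e) = ((φ x).1, (φ x).2 + r) := by
    intro x r
    simp only [φ, inner_add_right, real_inner_smul_right, hee, mul_one, add_smul, Prod.mk.injEq,
      and_true]
    abel
  let V : X × ℝ → ℝ := fun p => U (ι p) + ⟪e, ι p⟫ ^ 2 / (2 * lam)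
  have hVm : Measurable V := by fun_prop
  obtain ⟨c, hcm, hc⟩ := prod_density (Q.map φ) V (fun p => β (ι p)) hVm (hβm.comp hιm)
    (by
      intro z t
      have h1 : HasDerivAt (fun t : ℝ => z + t • e) e t := by
        simpa using ((hasDerivAt_id t).smul_const e).const_add z
      have h2 : HasDerivAt (fun t : ℝ => U (z + t • e)) ⟪DU (z + t • e), e⟫ t := by
        have := (hU (z + t • e)).comp_hasDerivAt t h1
        exact HasDerivAt.congr_deriv this (by simp)
      have h3 : HasDerivAt (fun t : ℝ => ⟪e, z + t • e⟫) ⟪e, e⟫ t := by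
        have := (innerSL ℝ e).hasFDerivAt.comp_hasDerivAt t h1
        exact HasDerivAt.congr_deriv this (by simp)
      have h4 := h2.add ((h3.pow 2).div_const (2 * (lam : ℝ)))
      refine h4.congr_deriv ?_
      simp only [β, ι, hee, real_inner_comm e]
      field_simp
      push_cast
      ring)
    (by
      rw [lintegral_map (by fun_prop) hφm]
      simp only [hιφ]
      have := ((integrable_const (1:ℝ)).sub hβi).2
      rw [hasFiniteIntegral_iff_norm] at this
      exact this.ne)
    (by
      intro f hf
      have hmm : Measurable fun p : X × ℝ => ∫⁻ r, expKer r * f (p.1, p.2 + r) := by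
        have := measurable_expKer
        apply Measurable.lintegral_prod_right' (f := fun x : (X × ℝ) × ℝ =>
          expKer x.2 * f (x.1.1, x.1.2 + x.2))
        fun_prop
      have hmm' : Measurable fun x => ∫⁻ r, expKer r * f ((φ x).1, (φ x).2 + r) := hmm.comp hφm
      have h1 := congrArg (fun m => ∫⁻ x, f (φ x) ∂m) hconv
      have h2 : ∀ g : X → ENNReal, Measurable g →
          ∫⁻ x, f (φ x) ∂((Q.withDensity g) ∗
            ((volume : Measure ℝ).withDensity expKer).map (fun r => r • e))
          = ∫⁻ x, g x * (∫⁻ r, expKer r * f ((φ x).1, (φ x).2 + r)) ∂Q := by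
        intro g hg
        rw [Measure.lintegral_conv (by fun_prop)]
        have h3 : ∀ x, ∫⁻ y, f (φ (x + y)) ∂((volume : Measure ℝ).withDensity expKer).map
            (fun r => r • e) = ∫⁻ r, expKer r * f ((φ x).1, (φ x).2 + r) := by
          intro x
          rw [lintegral_map (by fun_prop) (by fun_prop),
            lintegral_withDensity_eq_lintegral_mul _ measurable_expKer (by fun_prop)]
          simp only [Pi.mul_apply, hφadd]
        simp only [h3]
        rw [lintegral_withDensity_eq_lintegral_mul _ hg hmm']
        rfl
      simp only [lintegral_add_measure] at h1
      rw [h2 _ (by fun_prop), h2 _ (by fun_prop)] at h1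
      rw [lintegral_map (by fun_prop) hφm, lintegral_map (by fun_prop) hφm,
        lintegral_map (by fun_prop) hφm]
      simp only [hιφ]
      exact h1)
  have hfst : (Q.map φ).fst = Q.map (fun x => x - ⟪e, x⟫ • e) := by
    rw [Measure.fst, Measure.map_map measurable_fst hφm]; rfl
  rw [hfst] at hc
  set π := Q.map (fun x => x - ⟪e, x⟫ • e) with hπ
  have hπ0 : ∀ᵐ z ∂π, ⟪e, z⟫ = 0 := by
    rw [hπ, ae_map_iff (by fun_prop) (measurableSet_eq_fun (by fun_prop) (by fun_prop))]
    refine Filter.Eventually.of_forall fun x => ?_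
    rw [inner_sub_right, real_inner_smul_right, hee]; ring
  have hK : 0 < Real.sqrt (2 * Real.pi * lam) := by
    apply Real.sqrt_pos.2
    have := lam.2
    have : 0 < (lam : ℝ) := lt_of_le_of_ne lam.2 (Ne.symm hlam')
    positivity
  let K : ENNReal := ENNReal.ofReal (Real.sqrt (2 * Real.pi * lam))
  refine ⟨π.withDensity (fun z => c z * K), inferInstance,
    (withDensity_absolutelyContinuous _ _).ae_le hπ0, ?_⟩
  refine Measure.ext_of_lintegral _ fun f hf => ?_
  rw [lintegral_map hf hιm, lintegral_prod _ (by fun_prop),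
    lintegral_withDensity_eq_lintegral_mul _ (by fun_prop) hf,
    lintegral_withDensity_eq_lintegral_mul _ (by fun_prop) (by
      apply Measurable.lintegral_prod_right' (f := fun x : X × ℝ => f (x.1 + x.2 • e)); fun_prop)]
  have h5 := hc (fun p => f (ι p) * ENNReal.ofReal (Real.exp (-(⟪e, ι p⟫ ^ 2 / (2 * lam)))))
    (by fun_prop)
  rw [lintegral_map (by fun_prop) hφm] at h5
  simp only [hιφ] at h5
  have h6 : ∀ x, (f x * ENNReal.ofReal (Real.exp (-(⟪e, x⟫ ^ 2 / (2 * lam)))))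
      * ENNReal.ofReal (Real.exp (V (φ x))) = ENNReal.ofReal (Real.exp (U x)) * f x := by
    intro x
    rw [mul_assoc, ← ENNReal.ofReal_mul (Real.exp_pos _).le, ← Real.exp_add, mul_comm]
    congr 3
    simp only [V, hιφ]; ring
  simp only [h6] at h5
  simp only [Pi.mul_apply]
  rw [h5]
  apply lintegral_congr_ae
  filter_upwards [hπ0] with z hz
  rw [mul_assoc]
  congr 1
  rw [gaussianReal_of_var_ne_zero _ hlam, lintegral_withDensity_eq_lintegral_mul _ (by fun_prop) (by fun_prop),
    ← lintegral_const_mul _ (by fun_prop)]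
  congr 1; funext t
  simp only [Pi.mul_apply, ι, inner_add_right, real_inner_smul_right, hee, hz, gaussianPDF, K]
  rw [← mul_assoc, ← ENNReal.ofReal_mul hK.le, mul_comm, gaussianPDFReal, ← mul_assoc,
    mul_inv_cancel₀ hK.ne', one_mul]
  congr 3
  ring
end disint

section swap
variable {X : Type*} [NormedAddCommGroup X] [InnerProductSpace ℝ X] [CompleteSpace X]
    [MeasurableSpace X] [BorelSpace X] [SecondCountableTopology X]

/-- Exchange the coordinates along `e` of two vectors. -/
noncomputable def swapAlong (e : X) (p : X × X) : X × X :=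
  (p.1 + ⟪e, p.2 - p.1⟫ • e, p.2 + ⟪e, p.1 - p.2⟫ • e)

lemma measurable_swapAlong (e : X) : Measurable (swapAlong e) := by
  unfold swapAlong; fun_prop

lemma swapAlong_apply (e : X) (he : ‖e‖ = 1) (z w : X) (hz : ⟪e, z⟫ = 0) (hw : ⟪e, w⟫ = 0)
    (s t : ℝ) : swapAlong e (z + s • e, w + t • e) = (z + t • e, w + s • e) := by
  have hee : ⟪e, e⟫ = 1 := by rw [real_inner_self_eq_norm_sq, he]; norm_num
  simp only [swapAlong, inner_add_right, inner_sub_right, real_inner_smul_right, hee, hz, hw]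
  congr 1 <;> module

lemma swap_preserving (e : X) (he : ‖e‖ = 1) (ν₁ ν₂ τ₁ τ₂ : Measure X) (γ : Measure ℝ)
    [SFinite τ₁] [SFinite τ₂] [SFinite γ]
    (h₁ : ∀ᵐ z ∂τ₁, ⟪e, z⟫ = 0) (h₂ : ∀ᵐ z ∂τ₂, ⟪e, z⟫ = 0)
    (hν₁ : ν₁ = (τ₁.prod γ).map (fun p => p.1 + p.2 • e))
    (hν₂ : ν₂ = (τ₂.prod γ).map (fun p => p.1 + p.2 • e)) :
    MeasurePreserving (swapAlong e) (ν₁.prod ν₂) (ν₁.prod ν₂) := by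
  have hTm := measurable_swapAlong e
  refine ⟨hTm, ?_⟩
  have hformula : ∀ F : X × X → ENNReal, Measurable F →
      ∫⁻ p, F p ∂(ν₁.prod ν₂)
        = ∫⁻ z, ∫⁻ w, ∫⁻ s, ∫⁻ t, F (z + s • e, w + t • e) ∂γ ∂γ ∂τ₂ ∂τ₁ := by
    intro F hF
    rw [hν₁, hν₂, lintegral_prod _ hF.aemeasurable, lintegral_map (by fun_prop) (by fun_prop),
      lintegral_prod _ (by fun_prop)]
    congr 1; funext z
    have e1 : ∀ s : ℝ, ∫⁻ y, F (z + s • e, y) ∂(τ₂.prod γ).map (fun p => p.1 + p.2 • e)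
        = ∫⁻ w, ∫⁻ t, F (z + s • e, w + t • e) ∂γ ∂τ₂ := by
      intro s
      rw [lintegral_map (by fun_prop) (by fun_prop), lintegral_prod _ (by fun_prop)]
    simp only [e1]
    rw [lintegral_lintegral_swap]
    apply Measurable.aemeasurable
    exact Measurable.lintegral_prod_right' (f := fun x : (ℝ × X) × ℝ =>
      F (z + x.1.1 • e, x.1.2 + x.2 • e)) (by fun_prop)
  refine Measure.ext_of_lintegral _ fun F hF => ?_
  rw [lintegral_map hF hTm, hformula _ hF, hformula (fun p => F (swapAlong e p)) (hF.comp hTm)]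
  apply lintegral_congr_ae
  filter_upwards [h₁] with z hz
  apply lintegral_congr_ae
  filter_upwards [h₂] with w hw
  simp only [swapAlong_apply e he z w hz hw]
  rw [lintegral_lintegral_swap (by fun_prop)]

lemma gaussian_factor (C : X →L[ℝ] X) (hCsa : IsSelfAdjoint C) (NC : Measure X)
    [IsProbabilityMeasure NC]
    (hpos : ∀ y : X, 0 ≤ ⟪C y, y⟫)
    (hNC : ∀ y : X, Measure.map (fun x => ⟪y, x⟫) NC
      = gaussianReal 0 (Real.toNNReal ⟪C y, y⟫))
    (e : X) (he : ‖e‖ = 1) (lam : NNReal) (hCe : C e = (lam : ℝ) • e) :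
    NC = ((NC.map (fun x => x - ⟪e, x⟫ • e)).prod (gaussianReal 0 lam)).map
      (fun p => p.1 + p.2 • e) := by
  have hee : ⟪e, e⟫ = 1 := by rw [real_inner_self_eq_norm_sq, he]; norm_num
  have hsym : ∀ x y, ⟪C x, y⟫ = ⟪x, C y⟫ := fun x y =>
    (ContinuousLinearMap.isSelfAdjoint_iff_isSymmetric.1 hCsa) x y
  have hch : ∀ u, charFun NC u = cexp (-(⟪C u, u⟫ : ℝ) / 2) := by
    intro u
    have h1 : charFun NC u = charFun (NC.map (fun x => ⟪u, x⟫)) 1 := by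
      rw [charFun_apply, charFun_apply, integral_map (by fun_prop) (by fun_prop)]
      congr 1; funext x
      simp [real_inner_comm]
    rw [h1, hNC, charFun_gaussianReal, Real.coe_toNNReal _ (hpos u)]
    congr 1; push_cast; ring
  have : IsProbabilityMeasure (NC.map (fun x => x - ⟪e, x⟫ • e)) :=
    Measure.isProbabilityMeasure_map (by fun_prop)
  apply Measure.ext_of_charFun
  funext u
  have h2 : charFun (NC.map (fun x => x - ⟪e, x⟫ • e)) u = charFun NC (u - ⟪e, u⟫ • e) := by
    rw [charFun_apply, charFun_apply, integral_map (by fun_prop) (by fun_prop)]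
    congr 1; funext x
    congr 3
    simp only [inner_sub_left, inner_sub_right, real_inner_smul_left, real_inner_smul_right,
      real_inner_comm e]
    ring
  have h3 : charFun (((NC.map (fun x => x - ⟪e, x⟫ • e)).prod (gaussianReal 0 lam)).map
      (fun p => p.1 + p.2 • e)) u
      = charFun (NC.map (fun x => x - ⟪e, x⟫ • e)) u * charFun (gaussianReal 0 lam) ⟪e, u⟫ := by
    rw [charFun_apply, integral_map (by fun_prop) (by fun_prop), charFun_apply, charFun_apply,
      ← integral_prod_mul]
    congr 1; funext p
    rw [← Complex.exp_add, inner_add_left, real_inner_smul_left]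
    congr 1
    simp
    ring
  rw [h3, h2, hch, hch, charFun_gaussianReal, ← Complex.exp_add]
  congr 1
  have h4 : ⟪C (u - ⟪e, u⟫ • e), u - ⟪e, u⟫ • e⟫ = ⟪C u, u⟫ - lam * ⟪e, u⟫ ^ 2 := by
    have h5 : ⟪C u, e⟫ = lam * ⟪e, u⟫ := by
      rw [hsym, hCe, real_inner_smul_right, real_inner_comm]
    simp only [map_sub, map_smul, hCe, inner_sub_left, inner_sub_right, real_inner_smul_left,
      real_inner_smul_right, hee, h5]
    ring
  rw [h4]
  push_cast; ring

/-- Exchange the first `n` coordinates of two vectors. -/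
noncomputable def swapN (e : ℕ → X) (n : ℕ) (p : X × X) : X × X :=
  (p.1 + ∑ j ∈ Finset.range n, ⟪e j, p.2 - p.1⟫ • e j,
    p.2 + ∑ j ∈ Finset.range n, ⟪e j, p.1 - p.2⟫ • e j)

lemma swapN_succ (e : ℕ → X) (he : Orthonormal ℝ e) (n : ℕ) :
    swapN e (n + 1) = swapAlong (e n) ∘ swapN e n := by
  funext p
  have h : ∀ v : ℕ → ℝ, ⟪e n, ∑ j ∈ Finset.range n, v j • e j⟫ = 0 := by
    intro v
    rw [inner_sum]
    apply Finset.sum_eq_zero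
    intro j hj
    rw [real_inner_smul_right, he.2 (by have := Finset.mem_range.1 hj; omega), mul_zero]
  simp only [swapN, swapAlong, Function.comp, Finset.sum_range_succ, inner_sub_right,
    inner_add_right, h]
  congr 1 <;> module

lemma swap_ineq (e : HilbertBasis ℕ ℝ X) (ν NC : Measure X) [SFinite ν] [SFinite NC]
    (hT : ∀ j, MeasurePreserving (swapAlong (e j)) (ν.prod NC) (ν.prod NC))
    (f g : X → NNReal) (hf : Continuous f) (hg : Continuous g) :
    (∫⁻ x, g x ∂ν) * (∫⁻ x, f x ∂NC) ≤ (∫⁻ x, f x ∂ν) * (∫⁻ x, g x ∂NC) := by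
  have hS : ∀ n, MeasurePreserving (swapN (fun j => e j) n) (ν.prod NC) (ν.prod NC) := by
    intro n
    induction n with
    | zero =>
      have : swapN (fun j => e j) 0 = id := by funext p; simp [swapN]
      rw [this]; exact MeasurePreserving.id _
    | succ n ih =>
      rw [swapN_succ _ e.orthonormal]
      exact (hT n).comp ih
  have hlim : ∀ p : X × X, Tendsto (fun n => swapN (fun j => e j) n p) atTop
      (nhds (p.2, p.1)) := by
    intro p
    have h1 : ∀ v : X, Tendsto (fun n => ∑ j ∈ Finset.range n, ⟪e j, v⟫ • e j) atTop (nhds v) := by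
      intro v
      have := (e.hasSum_repr v).tendsto_sum_nat
      simpa only [HilbertBasis.repr_apply_apply] using this
    have h2 := ((h1 (p.2 - p.1)).const_add p.1).prodMk_nhds ((h1 (p.1 - p.2)).const_add p.2)
    simpa [swapN] using h2
  let F : X × X → ENNReal := fun p => ((f p.1 * g p.2 : NNReal) : ENNReal)
  have hFc : Continuous F := by fun_prop
  have hFm : Measurable F := hFc.measurable
  have e1 : (∫⁻ x, f x ∂ν) * (∫⁻ x, g x ∂NC) = ∫⁻ p, F p ∂(ν.prod NC) := by
    rw [← lintegral_prod_mul hf.measurable.coe_nnreal_ennreal.aemeasurable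
      hg.measurable.coe_nnreal_ennreal.aemeasurable]
    simp [F]
  have e2 : (∫⁻ x, g x ∂ν) * (∫⁻ x, f x ∂NC) = ∫⁻ p, F (p.2, p.1) ∂(ν.prod NC) := by
    rw [← lintegral_prod_mul hg.measurable.coe_nnreal_ennreal.aemeasurable
      hf.measurable.coe_nnreal_ennreal.aemeasurable]
    simp [F, mul_comm]
  rw [e1, e2]
  calc ∫⁻ p, F (p.2, p.1) ∂(ν.prod NC)
      = ∫⁻ p, liminf (fun n => F (swapN (fun j => e j) n p)) atTop ∂(ν.prod NC) := by
        congr 1; funext p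
        exact ((hFc.tendsto _).comp (hlim p)).liminf_eq.symm
    _ ≤ liminf (fun n => ∫⁻ p, F (swapN (fun j => e j) n p) ∂(ν.prod NC)) atTop :=
        lintegral_liminf_le fun n => hFm.comp (hS n).measurable
    _ = ∫⁻ p, F p ∂(ν.prod NC) := by
        simp only [fun n => (hS n).lintegral_comp hFm]
        simp

/-- A measure sharing all one-dimensional conditional laws with the Gibbs measure `P` is `P`. -/
lemma gibbs_unique (e : HilbertBasis ℕ ℝ X) (U : X → ℝ) (hU : Continuous U)
    (NC Q P : Measure X) [IsProbabilityMeasure NC] [IsProbabilityMeasure Q]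
    [IsProbabilityMeasure P] (Z : ℝ) (hZ : 0 < Z)
    (hZe : ∫⁻ x, ENNReal.ofReal (Real.exp (-U x)) ∂NC = ENNReal.ofReal Z)
    (hP : P = (ENNReal.ofReal Z)⁻¹ • NC.withDensity (fun x => ENNReal.ofReal (Real.exp (-U x))))
    (hT : ∀ j, MeasurePreserving (swapAlong (e j))
      ((Q.withDensity fun x => ENNReal.ofReal (Real.exp (U x))).prod NC)
      ((Q.withDensity fun x => ENNReal.ofReal (Real.exp (U x))).prod NC)) : Q = P := by
  refine ext_of_forall_lintegral_eq_of_IsFiniteMeasure fun φ => ?_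
  let w : X → NNReal := fun x => Real.toNNReal (Real.exp (-U x))
  have hw : Continuous w := by fun_prop
  let f : X → NNReal := fun x => φ x * w x
  have hf : Continuous f := by fun_prop
  have h := le_antisymm (swap_ineq e _ NC hT f w hf hw) (swap_ineq e _ NC hT w f hw hf)
  have hcancel : ∀ x, ENNReal.ofReal (Real.exp (U x)) * (w x : ENNReal) = 1 := by
    intro x
    show ENNReal.ofReal (Real.exp (U x)) * ENNReal.ofReal (Real.exp (-U x)) = 1
    rw [← ENNReal.ofReal_mul (Real.exp_pos _).le, ← Real.exp_add]; simp
  have e1 : ∫⁻ x, w x ∂(Q.withDensity fun x => ENNReal.ofReal (Real.exp (U x))) = 1 := by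
    rw [lintegral_withDensity_eq_lintegral_mul _ (by fun_prop) (by fun_prop)]
    simp [hcancel]
  have e2 : ∫⁻ x, f x ∂(Q.withDensity fun x => ENNReal.ofReal (Real.exp (U x)))
      = ∫⁻ x, φ x ∂Q := by
    rw [lintegral_withDensity_eq_lintegral_mul _ (by fun_prop) (by fun_prop)]
    congr 1; funext x
    simp only [Pi.mul_apply, f, ENNReal.coe_mul]
    rw [mul_left_comm, hcancel, mul_one]
  have e3 : ∫⁻ x, w x ∂NC = ENNReal.ofReal Z := hZe
  have e4 : ∫⁻ x, φ x ∂P = (ENNReal.ofReal Z)⁻¹ * ∫⁻ x, f x ∂NC := by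
    rw [hP, lintegral_smul_measure,
      lintegral_withDensity_eq_lintegral_mul _ (by fun_prop) (by fun_prop)]
    simp only [smul_eq_mul]
    congr 2; funext x
    simp only [Pi.mul_apply, f, ENNReal.coe_mul]
    rw [mul_comm]; rfl
  rw [e1, e2, e3, one_mul] at h
  rw [e4, h, mul_comm, mul_assoc, ENNReal.mul_inv_cancel (by simpa using hZ) ENNReal.ofReal_ne_top,
    mul_one]
end swap
section kernel
variable {X : Type*} [NormedAddCommGroup X] [InnerProductSpace ℝ X] [CompleteSpace X]
    [MeasurableSpace X] [BorelSpace X] [SecondCountableTopology X]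

lemma fderiv_trig_integral (μ : Measure X) [IsFiniteMeasure μ]
    (g g' : ℝ → ℝ) (hg : ∀ t, HasDerivAt g (g' t) t) (hg'c : Continuous g')
    (hgb : ∀ t, |g t| ≤ 1) (hgb' : ∀ t, |g' t| ≤ 1)
    (w ψ : X → ℝ) (hw : Continuous w) (hψ : Continuous ψ) (s : ℝ) (hs : |s| = 1)
    (hwi : Integrable w μ) (hwi2 : Integrable (fun u => |w u| * ‖u‖) μ) (z h : X) :
    fderiv ℝ (fun z => ∫ u, g (s * ⟪z, u⟫ + ψ u) * w u ∂μ) z h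
      = ∫ u, g' (s * ⟪z, u⟫ + ψ u) * s * w u * ⟪h, u⟫ ∂μ := by
  have hgc : Continuous g := continuous_iff_continuousAt.2 fun t => (hg t).continuousAt
  have hF'm : Continuous fun u : X =>
      (g' (s * ⟪z, u⟫ + ψ u) * s * w u) • (innerSL ℝ u : X →L[ℝ] ℝ) := by fun_prop
  have hb : ∀ u (x : X), ‖(g' (s * ⟪x, u⟫ + ψ u) * s * w u) • (innerSL ℝ u : X →L[ℝ] ℝ)‖
      ≤ |w u| * ‖u‖ := by
    intro u x
    rw [norm_smul, innerSL_apply_norm, Real.norm_eq_abs, abs_mul, abs_mul, hs, mul_one]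
    have := hgb' (s * ⟪x, u⟫ + ψ u)
    have h1 : |g' (s * ⟪x, u⟫ + ψ u)| * |w u| ≤ 1 * |w u| := by gcongr
    rw [one_mul] at h1
    gcongr
  have key := hasFDerivAt_integral_of_dominated_of_fderiv_le (μ := μ) (𝕜 := ℝ)
    (F := fun z u => g (s * ⟪z, u⟫ + ψ u) * w u)
    (F' := fun z u => (g' (s * ⟪z, u⟫ + ψ u) * s * w u) • (innerSL ℝ u : X →L[ℝ] ℝ))
    (bound := fun u => |w u| * ‖u‖) (x₀ := z) (s := Set.univ) Filter.univ_mem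
    (Filter.Eventually.of_forall fun x => by
      apply Continuous.aestronglyMeasurable; fun_prop)
    (by
      refine Integrable.mono' hwi.abs (by apply Continuous.aestronglyMeasurable; fun_prop) ?_
      refine Filter.Eventually.of_forall fun u => ?_
      rw [Real.norm_eq_abs, abs_mul]
      have := hgb (s * ⟪z, u⟫ + ψ u)
      nlinarith [abs_nonneg (w u)])
    hF'm.aestronglyMeasurable
    (Filter.Eventually.of_forall fun u x _ => hb u x) hwi2
    (Filter.Eventually.of_forall fun u x _ => by
      have h1 : HasFDerivAt (fun x : X => s * ⟪x, u⟫ + ψ u) (s • (innerSL ℝ u : X →L[ℝ] ℝ)) x := by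
        have h2 := ((innerSL ℝ u : X →L[ℝ] ℝ).hasFDerivAt (x := x)).const_mul s
        have h3 := h2.add_const (ψ u)
        refine h3.congr_of_eventuallyEq (Filter.Eventually.of_forall fun y => ?_)
        simp [real_inner_comm]
      have h4 := ((hg _).comp_hasFDerivAt x h1).mul_const (w u)
      refine h4.congr_fderiv ?_
      ext v
      simp
      ring)
  rw [key.fderiv, ContinuousLinearMap.integral_apply]
  · congr 1; funext u
    simp [real_inner_comm]
  · exact Integrable.mono' hwi2 hF'm.aestronglyMeasurable (Filter.Eventually.of_forall fun u => hb u z)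

/-- First (real) Stein feature. -/
noncomputable def feaA (C : X →L[ℝ] X) (b : X → X) (x u : X) : X :=
  Real.cos ⟪x, u⟫ • b x + Real.sin ⟪x, u⟫ • C u

/-- Second (imaginary) Stein feature. -/
noncomputable def feaB (C : X →L[ℝ] X) (b : X → X) (x u : X) : X :=
  Real.cos ⟪x, u⟫ • C u - Real.sin ⟪x, u⟫ • b x

lemma hv_formula (C : X →L[ℝ] X) (hCsa : IsSelfAdjoint C)
    (e : HilbertBasis ℕ ℝ X) (l : ℕ → ℝ) (hCe : ∀ i, C (e i) = l i • e i)
    (DU : X → X) (μ : Measure X) [IsFiniteMeasure μ]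
    (hμ2 : Integrable (fun s => ‖s‖ ^ 2) μ)
    (k : X → X → ℝ)
    (hk : ∀ x y : X, (k x y : ℂ) = ∫ u, Complex.exp ((⟪x - y, u⟫ : ℂ) * Complex.I) ∂μ) (x x' : X) :
    steinKernelHv k C DU (fun i => e i) l x x' =
      ∫ u, (⟪feaA C (fun x => x + C (DU x)) x u, feaA C (fun x => x + C (DU x)) x' u⟫
        + ⟪feaB C (fun x => x + C (DU x)) x u, feaB C (fun x => x + C (DU x)) x' u⟫) ∂μ := by
  have hsym : ∀ x y, ⟪C x, y⟫ = ⟪x, C y⟫ := fun x y =>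
    (ContinuousLinearMap.isSelfAdjoint_iff_isSymmetric.1 hCsa) x y
  have hμ1 : Integrable (fun s : X => ‖s‖) μ := by
    refine Integrable.mono' ((integrable_const (1:ℝ)).add hμ2)
      (by apply Continuous.aestronglyMeasurable; fun_prop) (Filter.Eventually.of_forall fun u => ?_)
    simp only [norm_norm, Pi.add_apply]
    nlinarith [sq_nonneg (‖u‖ - 1)]
  have hk1 : ∀ x y, k x y = ∫ u, Real.cos ⟪x - y, u⟫ ∂μ := by
    intro x y
    have h1 := congrArg Complex.re (hk x y)
    rw [Complex.ofReal_re, ← RCLike.re_eq_complex_re, ← integral_re] at h1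
    · rw [h1]; congr 1; funext u
      simp [Complex.exp_ofReal_mul_I_re]
    · refine Integrable.mono' (integrable_const (1:ℝ))
        (by apply Continuous.aestronglyMeasurable; fun_prop) (Filter.Eventually.of_forall fun u => ?_)
      rw [Complex.norm_exp_ofReal_mul_I]
  have hcos : ∀ t, HasDerivAt Real.cos (-Real.sin t) t := Real.hasDerivAt_cos
  have hmsin : ∀ t, HasDerivAt (fun t => -Real.sin t) (-Real.cos t) t :=
    fun t => (Real.hasDerivAt_sin t).neg
  -- derivative in the first variable
  have hd1 : ∀ x y h, fderiv ℝ (fun x1 => k x1 y) x h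
      = ∫ u, -Real.sin ⟪x - y, u⟫ * ⟪h, u⟫ ∂μ := by
    intro x y h
    have := fderiv_trig_integral μ Real.cos (fun t => -Real.sin t) hcos (by fun_prop)
      Real.abs_cos_le_one (fun t => by rw [abs_neg]; exact Real.abs_sin_le_one t)
      (fun _ => 1) (fun u => -⟪y, u⟫) (by fun_prop) (by fun_prop) 1 (by simp)
      (integrable_const _) (by simpa using hμ1) x h
    simp only [one_mul, mul_one, ← sub_eq_add_neg, ← inner_sub_left] at this
    simp only [hk1]
    exact this
  have hd2 : ∀ x y h, fderiv ℝ (fun y1 => k x y1) y h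
      = ∫ u, Real.sin ⟪x - y, u⟫ * ⟪h, u⟫ ∂μ := by
    intro x y h
    have := fderiv_trig_integral μ Real.cos (fun t => -Real.sin t) hcos (by fun_prop)
      Real.abs_cos_le_one (fun t => by rw [abs_neg]; exact Real.abs_sin_le_one t)
      (fun _ => 1) (fun u => ⟪x, u⟫) (by fun_prop) (by fun_prop) (-1) (by simp)
      (integrable_const _) (by simpa using hμ1) y h
    have e1 : ∀ (y u : X), -1 * ⟪y, u⟫ + ⟪x, u⟫ = ⟪x - y, u⟫ := by
      intro y u; rw [inner_sub_left]; ring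
    simp only [e1, mul_one, mul_neg, neg_neg] at this
    simp only [hk1]
    exact this
  have hint2 : ∀ (h : X), Integrable (fun u => |⟪h, u⟫| * ‖u‖) μ := by
    intro h
    refine Integrable.mono' (hμ2.const_mul ‖h‖)
      (by apply Continuous.aestronglyMeasurable; fun_prop) (Filter.Eventually.of_forall fun u => ?_)
    rw [Real.norm_eq_abs, abs_mul, abs_abs, abs_norm]
    have := abs_real_inner_le_norm h u
    calc |⟪h, u⟫| * ‖u‖ ≤ (‖h‖ * ‖u‖) * ‖u‖ := by gcongr
      _ = _ := by ring
  have hint1 : ∀ (h : X), Integrable (fun u => ⟪h, u⟫) μ := by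
    intro h
    refine Integrable.mono' (hμ1.const_mul ‖h‖)
      (by apply Continuous.aestronglyMeasurable; fun_prop) (Filter.Eventually.of_forall fun u => ?_)
    exact abs_real_inner_le_norm h u
  have hint3 : ∀ (h : X), Integrable (fun u => ⟪h, u⟫ * ⟪h, u⟫) μ := by
    intro h
    refine Integrable.mono' ((hint2 h).const_mul ‖h‖)
      (by apply Continuous.aestronglyMeasurable; fun_prop) (Filter.Eventually.of_forall fun u => ?_)
    rw [Real.norm_eq_abs, abs_mul]
    have := abs_real_inner_le_norm h u
    calc |⟪h, u⟫| * |⟪h, u⟫| ≤ |⟪h, u⟫| * (‖h‖ * ‖u‖) := by gcongr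
      _ = _ := by ring
  have hd12 : ∀ x y h, fderiv ℝ (fun y1 => fderiv ℝ (fun x1 => k x1 y1) x h) y h
      = ∫ u, Real.cos ⟪x - y, u⟫ * (⟪h, u⟫ * ⟪h, u⟫) ∂μ := by
    intro x y h
    have := fderiv_trig_integral μ (fun t => -Real.sin t) (fun t => -Real.cos t) hmsin (by fun_prop)
      (fun t => by rw [abs_neg]; exact Real.abs_sin_le_one t)
      (fun t => by rw [abs_neg]; exact Real.abs_cos_le_one t)
      (fun u => ⟪h, u⟫) (fun u => ⟪x, u⟫) (by fun_prop) (by fun_prop) (-1) (by simp)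
      (hint1 h) (hint2 h) y h
    have e1 : ∀ (y u : X), -1 * ⟪y, u⟫ + ⟪x, u⟫ = ⟪x - y, u⟫ := by
      intro y u; rw [inner_sub_left]; ring
    simp only [e1, mul_one, mul_neg, neg_neg] at this
    simp only [hd1]
    rw [this]
    congr 1; funext u; ring
  have hcoef : ∀ u i, l i * ⟪e i, u⟫ = ⟪e i, C u⟫ := by
    intro u i
    rw [← hsym, hCe, real_inner_smul_left]
  have hpars : ∀ u, HasSum (fun i => l i ^ 2 * (⟪e i, u⟫ * ⟪e i, u⟫)) (‖C u‖ ^ 2) := by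
    intro u
    have h1 := e.hasSum_inner_mul_inner (C u) (C u)
    rw [real_inner_self_eq_norm_sq] at h1
    have h2 : (fun i => l i ^ 2 * (⟪e i, u⟫ * ⟪e i, u⟫)) = fun i => ⟪C u, e i⟫ * ⟪e i, C u⟫ := by
      funext i
      rw [real_inner_comm (e i) (C u), ← hcoef]; ring
    rw [h2]; exact h1
  have hCu2 : Integrable (fun u => ‖C u‖ ^ 2) μ := by
    refine Integrable.mono' (hμ2.const_mul (‖C‖ ^ 2))
      (by apply Continuous.aestronglyMeasurable; fun_prop) (Filter.Eventually.of_forall fun u => ?_)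
    rw [Real.norm_of_nonneg (by positivity), ← mul_pow]
    gcongr
    exact C.le_opNorm u
  have htsum : ∑' i, l i ^ 2 * fderiv ℝ (fun y1 => fderiv ℝ (fun x1 => k x1 y1) x (e i)) x' (e i)
      = ∫ u, Real.cos ⟪x - x', u⟫ * ‖C u‖ ^ 2 ∂μ := by
    have hcb : ∀ i, Integrable (fun u => l i ^ 2 * (⟪e i, u⟫ * ⟪e i, u⟫)) μ := fun i =>
      (hint3 (e i)).const_mul _
    have hFi : ∀ i, Integrable (fun u => Real.cos ⟪x - x', u⟫ * (l i ^ 2 * (⟪e i, u⟫ * ⟪e i, u⟫))) μ := by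
      intro i
      refine Integrable.mono' (hcb i)
        (by apply Continuous.aestronglyMeasurable; fun_prop) (Filter.Eventually.of_forall fun u => ?_)
      rw [norm_mul, Real.norm_of_nonneg (mul_nonneg (sq_nonneg _) (mul_self_nonneg _))]
      exact mul_le_of_le_one_left (mul_nonneg (sq_nonneg _) (mul_self_nonneg _))
        (Real.abs_cos_le_one _)
    have hs := hasSum_integral_of_summable_integral_norm hFi (by
      refine summable_of_sum_le (c := ∫ u, ‖C u‖ ^ 2 ∂μ) (fun i => by positivity) ?_
      intro s
      rw [← integral_finsetSum _ fun i _ => (hFi i).norm]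
      refine integral_mono (integrable_finsetSum _ fun i _ => (hFi i).norm) hCu2 fun u => ?_
      calc ∑ i ∈ s, ‖Real.cos ⟪x - x', u⟫ * (l i ^ 2 * (⟪e i, u⟫ * ⟪e i, u⟫))‖
          ≤ ∑ i ∈ s, l i ^ 2 * (⟪e i, u⟫ * ⟪e i, u⟫) := by
            refine Finset.sum_le_sum fun i _ => ?_
            rw [norm_mul, Real.norm_of_nonneg (mul_nonneg (sq_nonneg _) (mul_self_nonneg _))]
            exact mul_le_of_le_one_left (mul_nonneg (sq_nonneg _) (mul_self_nonneg _))
              (Real.abs_cos_le_one _)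
        _ ≤ ‖C u‖ ^ 2 := sum_le_hasSum s
            (fun i _ => mul_nonneg (sq_nonneg _) (mul_self_nonneg _)) (hpars u))
    simp only [hd12]
    have e2 : ∀ i, l i ^ 2 * ∫ u, Real.cos ⟪x - x', u⟫ * (⟪e i, u⟫ * ⟪e i, u⟫) ∂μ
        = ∫ u, Real.cos ⟪x - x', u⟫ * (l i ^ 2 * (⟪e i, u⟫ * ⟪e i, u⟫)) ∂μ := by
      intro i
      rw [← integral_const_mul]; congr 1; funext u; ring
    simp only [e2]
    rw [hs.tsum_eq]
    congr 1; funext u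
    rw [tsum_mul_left, (hpars u).tsum_eq]
  have hi1 : Integrable (fun u => Real.cos ⟪x - x', u⟫ * ‖C u‖ ^ 2) μ := by
    refine Integrable.mono' hCu2
      (by apply Continuous.aestronglyMeasurable; fun_prop) (Filter.Eventually.of_forall fun u => ?_)
    rw [norm_mul, Real.norm_of_nonneg (by positivity : (0:ℝ) ≤ ‖C u‖ ^ 2)]
    exact mul_le_of_le_one_left (by positivity) (Real.abs_cos_le_one _)
  have hi2 : ∀ h : X, Integrable (fun u => Real.sin ⟪x - x', u⟫ * ⟪h, u⟫) μ := by
    intro h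
    refine Integrable.mono' (hint1 h).norm
      (by apply Continuous.aestronglyMeasurable; fun_prop) (Filter.Eventually.of_forall fun u => ?_)
    rw [norm_mul]
    exact mul_le_of_le_one_left (by positivity) (Real.abs_sin_le_one _)
  have hi3 : Integrable (fun u => Real.cos ⟪x - x', u⟫) μ := by
    refine Integrable.mono' (integrable_const (1:ℝ))
      (by apply Continuous.aestronglyMeasurable; fun_prop) (Filter.Eventually.of_forall fun u => ?_)
    exact Real.abs_cos_le_one _
  have hi2' : ∀ h : X, Integrable (fun u => -Real.sin ⟪x - x', u⟫ * ⟪h, u⟫) μ := by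
    intro h
    have := (hi2 h).neg
    refine this.congr (Filter.Eventually.of_forall fun u => ?_)
    simp
  have hi4 : ∀ h : X, Integrable (fun u => Real.cos ⟪x - x', u⟫ * ‖C u‖ ^ 2
      - -Real.sin ⟪x - x', u⟫ * ⟪h, u⟫) μ := fun h => hi1.sub (hi2' h)
  have hi5 : ∀ h h' : X, Integrable (fun u => Real.cos ⟪x - x', u⟫ * ‖C u‖ ^ 2
      - -Real.sin ⟪x - x', u⟫ * ⟪h, u⟫ - Real.sin ⟪x - x', u⟫ * ⟪h', u⟫) μ :=
    fun h h' => (hi4 h).sub (hi2 h')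
  rw [steinKernelHv, htsum, hd1, hd2, hk1, ← integral_mul_const, ← integral_sub hi1 (hi2' _),
    ← integral_sub (hi4 _) (hi2 _),
    ← integral_add (hi5 _ _) (hi3.mul_const _)]
  congr 1; funext u
  set b := x + C (DU x) with hb
  set b' := x' + C (DU x') with hb'
  have e1 : ⟪C x' + C (C (DU x')), u⟫ = ⟪b', C u⟫ := by rw [← map_add, ← hb', hsym]
  have e2 : ⟪C x + C (C (DU x)), u⟫ = ⟪b, C u⟫ := by rw [← map_add, ← hb, hsym]
  rw [e1, e2]
  simp only [feaA, feaB, ← hb, ← hb', inner_add_left, inner_add_right, inner_sub_left,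
    inner_sub_right, real_inner_smul_left, real_inner_smul_right, Real.cos_sub, Real.sin_sub,
    real_inner_self_eq_norm_sq]
  rw [real_inner_comm (C u) b, real_inner_comm (C u) b']
  ring

lemma norm_feaA_le (C : X →L[ℝ] X) (b : X → X) (x u : X) : ‖feaA C b x u‖ ≤ ‖C u‖ + ‖b x‖ := by
  have h1 := Real.abs_cos_le_one ⟪x, u⟫
  have h2 := Real.abs_sin_le_one ⟪x, u⟫
  calc ‖feaA C b x u‖ ≤ |Real.cos ⟪x, u⟫| * ‖b x‖ + |Real.sin ⟪x, u⟫| * ‖C u‖ := by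
        unfold feaA
        refine (norm_add_le _ _).trans ?_
        simp [norm_smul]
    _ ≤ 1 * ‖b x‖ + 1 * ‖C u‖ := by gcongr
    _ = _ := by ring

lemma norm_feaB_le (C : X →L[ℝ] X) (b : X → X) (x u : X) : ‖feaB C b x u‖ ≤ ‖C u‖ + ‖b x‖ := by
  have h1 := Real.abs_cos_le_one ⟪x, u⟫
  have h2 := Real.abs_sin_le_one ⟪x, u⟫
  calc ‖feaB C b x u‖ ≤ |Real.cos ⟪x, u⟫| * ‖C u‖ + |Real.sin ⟪x, u⟫| * ‖b x‖ := by
        unfold feaB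
        refine (norm_sub_le _ _).trans ?_
        simp [norm_smul]
    _ ≤ 1 * ‖C u‖ + 1 * ‖b x‖ := by gcongr
    _ = _ := by ring

lemma measurable_feaA {α : Type*} [MeasurableSpace α] (C : X →L[ℝ] X) (b : X → X)
    (hb : Measurable b) (f g : α → X) (hf : Measurable f) (hg : Measurable g) :
    Measurable fun q => feaA C b (f q) (g q) := by
  have h1 : Measurable fun q => b (f q) := hb.comp hf
  have h2 : Measurable fun q => C (g q) := C.measurable.comp hg
  have h3 : Measurable fun q => ⟪f q, g q⟫ := hf.inner hg
  exact ((Real.measurable_cos.comp h3).smul h1).add ((Real.measurable_sin.comp h3).smul h2)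

lemma measurable_feaB {α : Type*} [MeasurableSpace α] (C : X →L[ℝ] X) (b : X → X)
    (hb : Measurable b) (f g : α → X) (hf : Measurable f) (hg : Measurable g) :
    Measurable fun q => feaB C b (f q) (g q) := by
  have h1 : Measurable fun q => b (f q) := hb.comp hf
  have h2 : Measurable fun q => C (g q) := C.measurable.comp hg
  have h3 : Measurable fun q => ⟪f q, g q⟫ := hf.inner hg
  exact ((Real.measurable_cos.comp h3).smul h2).sub ((Real.measurable_sin.comp h3).smul h1)

set_option maxHeartbeats 800000 in
lemma double_integral (C : X →L[ℝ] X) (b : X → X) (hbm : Measurable b)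
    (Q μ : Measure X) [IsProbabilityMeasure Q] [IsFiniteMeasure μ]
    (hb : Integrable b Q) (hμ2 : Integrable (fun s => ‖s‖ ^ 2) μ)
    (hμsupp : ∀ B : Set X, IsOpen B → B.Nonempty → 0 < μ B) :
    ∫ x, ∫ x', ∫ u, (⟪feaA C b x u, feaA C b x' u⟫ + ⟪feaB C b x u, feaB C b x' u⟫) ∂μ ∂Q ∂Q = 0
      ↔ ∀ u, ∫ x, feaA C b x u ∂Q = 0 ∧ ∫ x, feaB C b x u ∂Q = 0 := by
  have hdom : ∀ c : ℝ, Integrable (fun x => c + ‖b x‖) Q := fun c =>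
    (integrable_const c).add hb.norm
  have hAi : ∀ u, Integrable (fun x => feaA C b x u) Q := fun u =>
    Integrable.mono' (hdom ‖C u‖)
      (measurable_feaA C b hbm _ _ measurable_id measurable_const).aestronglyMeasurable
      (Filter.Eventually.of_forall fun x => norm_feaA_le C b x u)
  have hBi : ∀ u, Integrable (fun x => feaB C b x u) Q := fun u =>
    Integrable.mono' (hdom ‖C u‖)
      (measurable_feaB C b hbm _ _ measurable_id measurable_const).aestronglyMeasurable
      (Filter.Eventually.of_forall fun x => norm_feaB_le C b x u)
  have hC2 : Integrable (fun u => ‖C u‖ ^ 2) μ := by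
    refine Integrable.mono' (hμ2.const_mul (‖C‖ ^ 2))
      (by apply Continuous.aestronglyMeasurable; fun_prop) (Filter.Eventually.of_forall fun u => ?_)
    rw [Real.norm_of_nonneg (by positivity), ← mul_pow]
    gcongr
    exact C.le_opNorm u
  have hC1 : Integrable (fun u => ‖C u‖) μ := by
    refine Integrable.mono' ((integrable_const (1:ℝ)).add hC2)
      (by apply Continuous.aestronglyMeasurable; fun_prop) (Filter.Eventually.of_forall fun u => ?_)
    simp only [norm_norm, Pi.add_apply]
    nlinarith [sq_nonneg (‖C u‖ - 1)]
  let F : X × X → X → ℝ := fun p u =>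
    ⟪feaA C b p.1 u, feaA C b p.2 u⟫ + ⟪feaB C b p.1 u, feaB C b p.2 u⟫
  have hFm : Measurable (Function.uncurry F) := by
    have m1 : Measurable fun q : (X × X) × X => q.1.1 := measurable_fst.comp measurable_fst
    have m2 : Measurable fun q : (X × X) × X => q.1.2 := measurable_snd.comp measurable_fst
    have h1 : Measurable fun q : (X × X) × X => feaA C b q.1.1 q.2 :=
      measurable_feaA C b hbm _ _ m1 measurable_snd
    have h2 : Measurable fun q : (X × X) × X => feaA C b q.1.2 q.2 :=
      measurable_feaA C b hbm _ _ m2 measurable_snd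
    have h3 : Measurable fun q : (X × X) × X => feaB C b q.1.1 q.2 :=
      measurable_feaB C b hbm _ _ m1 measurable_snd
    have h4 : Measurable fun q : (X × X) × X => feaB C b q.1.2 q.2 :=
      measurable_feaB C b hbm _ _ m2 measurable_snd
    exact (h1.inner h2).add (h3.inner h4)
  have hone : Integrable (fun _ : X => (1:ℝ)) Q := integrable_const _
  have honeμ : Integrable (fun _ : X => (1:ℝ)) μ := integrable_const _
  have hFi : Integrable (Function.uncurry F) ((Q.prod Q).prod μ) := by
    have i1 := ((hone.mul_prod hone).mul_prod hC2)
    have i2 := ((hone.mul_prod hb.norm).mul_prod hC1)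
    have i3 := ((hb.norm.mul_prod hone).mul_prod hC1)
    have i4 := ((hb.norm.mul_prod hb.norm).mul_prod honeμ)
    refine Integrable.mono' ((((i1.add i2).add i3).add i4).const_mul 2) hFm.aestronglyMeasurable
      (Filter.Eventually.of_forall fun q => ?_)
    obtain ⟨⟨x, x'⟩, u⟩ := q
    have h1 : |⟪feaA C b x u, feaA C b x' u⟫| ≤ (‖C u‖ + ‖b x‖) * (‖C u‖ + ‖b x'‖) :=
      (abs_real_inner_le_norm _ _).trans
        (mul_le_mul (norm_feaA_le C b x u) (norm_feaA_le C b x' u) (norm_nonneg _) (by positivity))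
    have h2 : |⟪feaB C b x u, feaB C b x' u⟫| ≤ (‖C u‖ + ‖b x‖) * (‖C u‖ + ‖b x'‖) :=
      (abs_real_inner_le_norm _ _).trans
        (mul_le_mul (norm_feaB_le C b x u) (norm_feaB_le C b x' u) (norm_nonneg _) (by positivity))
    have h3 := (abs_add_le ⟪feaA C b x u, feaA C b x' u⟫ ⟪feaB C b x u, feaB C b x' u⟫).trans
      (add_le_add h1 h2)
    refine h3.trans (le_of_eq ?_)
    simp only [Pi.add_apply]
    ring
  let G : X → ℝ := fun u => ‖∫ x, feaA C b x u ∂Q‖ ^ 2 + ‖∫ x, feaB C b x u ∂Q‖ ^ 2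
  have hG : ∀ᵐ u ∂μ, ∫ p, F p u ∂(Q.prod Q) = G u := by
    filter_upwards [hFi.prod_left_ae] with u hu
    have h1 := integral_prod _ hu
    refine Eq.trans h1 ?_
    have h2 : ∀ x, ∫ x', F (x, x') u ∂Q
        = ⟪feaA C b x u, ∫ x', feaA C b x' u ∂Q⟫ + ⟪feaB C b x u, ∫ x', feaB C b x' u ∂Q⟫ := by
      intro x
      rw [← integral_inner (hAi u), ← integral_inner (hBi u), ← integral_add]
      · exact (hAi u).const_inner _
      · exact (hBi u).const_inner _
    refine (integral_congr_ae (Filter.Eventually.of_forall h2)).trans ?_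
    have j1 := (hAi u).const_inner (𝕜 := ℝ) (∫ x', feaA C b x' u ∂Q)
    have j2 := (hBi u).const_inner (𝕜 := ℝ) (∫ x', feaB C b x' u ∂Q)
    simp only [real_inner_comm (∫ x', feaA C b x' u ∂Q), real_inner_comm (∫ x', feaB C b x' u ∂Q)]
    rw [integral_add j1 j2, integral_inner (hAi u), integral_inner (hBi u),
      real_inner_self_eq_norm_sq, real_inner_self_eq_norm_sq]
  have hGi : Integrable G μ := hFi.integral_prod_right.congr hG
  have hmain : ∫ x, ∫ x', ∫ u, (⟪feaA C b x u, feaA C b x' u⟫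
      + ⟪feaB C b x u, feaB C b x' u⟫) ∂μ ∂Q ∂Q = ∫ u, G u ∂μ := by
    have h1 := integral_prod _ hFi.integral_prod_left
    rw [← integral_congr_ae hG, ← integral_integral_swap hFi]
    exact h1.symm
  have hdomc : ∀ u₀ : X, ∀ᶠ u in nhds u₀, ‖C u‖ ≤ ‖C u₀‖ + 1 := by
    intro u₀
    have : ContinuousAt (fun u => ‖C u‖) u₀ := by fun_prop
    exact (this.eventually (ge_mem_nhds (by linarith : ‖C u₀‖ < ‖C u₀‖ + 1)))
  have hcA : Continuous fun u => ∫ x, feaA C b x u ∂Q := by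
    rw [continuous_iff_continuousAt]
    intro u₀
    refine continuousAt_of_dominated (bound := fun x => (‖C u₀‖ + 1) + ‖b x‖)
      (Filter.Eventually.of_forall fun u => (hAi u).aestronglyMeasurable) ?_ (hdom _)
      (Filter.Eventually.of_forall fun x => ?_)
    · filter_upwards [hdomc u₀] with u hu
      exact Filter.Eventually.of_forall fun x => (norm_feaA_le C b x u).trans (by gcongr)
    · unfold feaA; fun_prop
  have hcB : Continuous fun u => ∫ x, feaB C b x u ∂Q := by
    rw [continuous_iff_continuousAt]
    intro u₀
    refine continuousAt_of_dominated (bound := fun x => (‖C u₀‖ + 1) + ‖b x‖)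
      (Filter.Eventually.of_forall fun u => (hBi u).aestronglyMeasurable) ?_ (hdom _)
      (Filter.Eventually.of_forall fun x => ?_)
    · filter_upwards [hdomc u₀] with u hu
      exact Filter.Eventually.of_forall fun x => (norm_feaB_le C b x u).trans (by gcongr)
    · unfold feaB; fun_prop
  have hGc : Continuous G := by fun_prop
  have hG0 : ∀ u, 0 ≤ G u := fun u => by positivity
  have : μ.IsOpenPosMeasure := ⟨fun B hB hne => (hμsupp B hB hne).ne'⟩
  rw [hmain, integral_eq_zero_iff_of_nonneg hG0 hGi,
    show (0 : X → ℝ) = fun _ => 0 from rfl, Continuous.ae_eq_iff_eq μ hGc continuous_const]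
  constructor
  · intro h u
    have h1 : ‖∫ x, feaA C b x u ∂Q‖ ^ 2 + ‖∫ x, feaB C b x u ∂Q‖ ^ 2 = 0 := congrFun h u
    have h2 := sq_nonneg ‖∫ x, feaA C b x u ∂Q‖
    have h3 := sq_nonneg ‖∫ x, feaB C b x u ∂Q‖
    constructor
    · exact norm_eq_zero.1 (pow_eq_zero_iff two_ne_zero |>.1 (by linarith))
    · exact norm_eq_zero.1 (pow_eq_zero_iff two_ne_zero |>.1 (by linarith))
  · intro h
    funext u
    simp [G, h u]
end kernel
section target
variable {X : Type*} [NormedAddCommGroup X] [InnerProductSpace ℝ X] [CompleteSpace X]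
    [MeasurableSpace X] [BorelSpace X] [SecondCountableTopology X]

lemma gaussian_ibp_real (lam : NNReal) (hlam : lam ≠ 0) (f f' : ℝ → ℝ)
    (hd : ∀ t, HasDerivAt f (f' t) t) (hf : Integrable f (gaussianReal 0 lam))
    (hG : Integrable (fun t => (lam : ℝ) * f' t - t * f t) (gaussianReal 0 lam)) :
    ∫ t, ((lam : ℝ) * f' t - t * f t) ∂(gaussianReal 0 lam) = 0 := by
  have hlam' : (lam : ℝ) ≠ 0 := by exact_mod_cast hlam
  have hI : ∀ g : ℝ → ℝ, Integrable g (gaussianReal 0 lam) →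
      Integrable (fun t => gaussianPDFReal 0 lam t * g t) := by
    intro g hg
    rw [gaussianReal_of_var_ne_zero _ hlam, integrable_withDensity_iff_integrable_smul'
      (measurable_gaussianPDF 0 lam)
      (Filter.Eventually.of_forall fun t => gaussianPDF_lt_top)] at hg
    simpa only [toReal_gaussianPDF, smul_eq_mul] using hg
  rw [integral_gaussianReal_eq_integral_smul hlam]
  have hpdf : ∀ t, HasDerivAt (gaussianPDFReal 0 lam)
      (gaussianPDFReal 0 lam t * (-t / lam)) t := by
    intro t
    have h1 : HasDerivAt (fun t : ℝ => -(t - 0) ^ 2 / (2 * (lam : ℝ))) (-t / lam) t := by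
      have := ((((hasDerivAt_id t).sub_const 0).pow 2).neg).div_const (2 * (lam : ℝ))
      refine this.congr_deriv ?_
      simp
      field_simp
    have h2 := (h1.exp).const_mul ((Real.sqrt (2 * Real.pi * lam))⁻¹)
    refine (h2.congr_deriv ?_)
    simp only [gaussianPDFReal]; ring
  refine integral_eq_zero_of_hasDerivAt_of_integrable
    (f := fun t => (lam : ℝ) * (gaussianPDFReal 0 lam t * f t)) (fun t => ?_) (hI _ hG)
    ((hI _ hf).const_mul _)
  refine (((hpdf t).mul (hd t)).const_mul (lam : ℝ)).congr_deriv ?_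
  simp only [smul_eq_mul]
  field_simp
  ring

lemma gaussian_ibp (NC τ : Measure X) [SFinite τ] (e : X) (he : ‖e‖ = 1)
    (lam : NNReal) (hlam : lam ≠ 0) (hτ : ∀ᵐ z ∂τ, ⟪e, z⟫ = 0)
    (hNC : NC = (τ.prod (gaussianReal 0 lam)).map (fun p => p.1 + p.2 • e))
    (f f' : X → ℝ) (hd : ∀ z t, HasDerivAt (fun t : ℝ => f (z + t • e)) (f' (z + t • e)) t)
    (hf : Integrable f NC) (hf' : Integrable f' NC) (hxf : Integrable (fun x => ⟪e, x⟫ * f x) NC) :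
    ∫ x, ((lam : ℝ) * f' x - ⟪e, x⟫ * f x) ∂NC = 0 := by
  have hee : ⟪e, e⟫ = 1 := by rw [real_inner_self_eq_norm_sq, he]; norm_num
  have hm : Measurable (fun p : X × ℝ => p.1 + p.2 • e) := by fun_prop
  have hG : Integrable (fun x => (lam : ℝ) * f' x - ⟪e, x⟫ * f x) NC := (hf'.const_mul _).sub hxf
  have hGs := hG.aestronglyMeasurable
  rw [hNC] at hG hf hGs ⊢
  rw [integrable_map_measure hG.aestronglyMeasurable hm.aemeasurable] at hG
  rw [integrable_map_measure hf.aestronglyMeasurable hm.aemeasurable] at hf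
  rw [integral_map hm.aemeasurable hGs]
  refine (integral_prod _ hG).trans ?_
  refine integral_eq_zero_of_ae ?_
  filter_upwards [hτ, hf.prod_right_ae, hG.prod_right_ae] with z hz h1 h2
  have h3 : ∀ t : ℝ, ⟪e, z + t • e⟫ = t := by
    intro t; rw [inner_add_right, real_inner_smul_right, hee, hz]; ring
  simp only [Function.comp_def, h3] at h1 h2 ⊢
  exact gaussian_ibp_real lam hlam _ _ (hd z) h1 h2

lemma inner_Csqrt (e : HilbertBasis ℕ ℝ X) (l : ℕ → ℝ) (Csqrt : X →L[ℝ] X)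
    (hCsqrt : ∀ i, Csqrt (e i) = Real.sqrt (l i) • e i) (j : ℕ) (x : X) :
    ⟪e j, Csqrt x⟫ = Real.sqrt (l j) * ⟪e j, x⟫ := by
  have h : ((innerSL ℝ (e j)).comp Csqrt) = Real.sqrt (l j) • (innerSL ℝ (e j) : X →L[ℝ] ℝ) := by
    refine ContinuousLinearMap.ext_on
      (Submodule.dense_iff_topologicalClosure_eq_top.2 e.dense_span) ?_
    rintro _ ⟨i, rfl⟩
    simp only [ContinuousLinearMap.comp_apply, smul_apply, innerSL_apply_apply,
      hCsqrt, real_inner_smul_right, smul_eq_mul]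
    by_cases hij : j = i
    · subst hij; rfl
    · rw [e.orthonormal.2 hij]; simp
  have := congrArg (fun T : X →L[ℝ] ℝ => T x) h
  simpa using this

lemma hilbert_eq_zero (e : HilbertBasis ℕ ℝ X) (v : X) (h : ∀ j, ⟪e j, v⟫ = 0) : v = 0 := by
  apply e.repr.injective
  ext j
  rw [HilbertBasis.repr_apply_apply, h]; simp

lemma target_component (NC τ : Measure X) [IsProbabilityMeasure NC] [SFinite τ]
    (U : X → ℝ) (DU : X → X)
    (hU : ∀ x, HasFDerivAt U ((InnerProductSpace.toDual ℝ X) (DU x) : X →L[ℝ] ℝ) x)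
    (e : X) (he : ‖e‖ = 1)
    (lam : NNReal) (hlam : lam ≠ 0) (hτ : ∀ᵐ z ∂τ, ⟪e, z⟫ = 0)
    (hNC : NC = (τ.prod (gaussianReal 0 lam)).map (fun p => p.1 + p.2 • e))
    (hexpU : Integrable (fun x => Real.exp (-U x)) NC)
    (h1 : Integrable (fun x => Real.exp (-U x) * ⟪e, DU x⟫) NC)
    (h2 : Integrable (fun x => Real.exp (-U x) * ⟪e, x⟫) NC)
    (g g' : ℝ → ℝ) (hg : ∀ t, HasDerivAt g (g' t) t) (hg'c : Continuous g')
    (hgb : ∀ t, |g t| ≤ 1) (hgb' : ∀ t, |g' t| ≤ 1) (u : X) :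
    ∫ x, Real.exp (-U x) * (lam * ⟪e, u⟫ * g' ⟪x, u⟫ - g ⟪x, u⟫ * (⟪e, x⟫ + lam * ⟪e, DU x⟫)) ∂NC
      = 0 := by
  have hDUm : Measurable DU := measurable_grad U DU hU
  have hUc : Continuous U := continuous_iff_continuousAt.2 fun x => (hU x).continuousAt
  have hgc : Continuous g := continuous_iff_continuousAt.2 fun t => (hg t).continuousAt
  have hUm : Measurable U := hUc.measurable
  have hmulb : ∀ (φ : ℝ → ℝ) (F : X → ℝ), Continuous φ → (∀ t, |φ t| ≤ 1) → Integrable F NC →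
      Integrable (fun x => φ ⟪x, u⟫ * F x) NC := by
    intro φ F hφ hb hF
    have hc : Continuous fun x : X => φ ⟪x, u⟫ := by fun_prop
    refine Integrable.mono' hF.norm (hc.aestronglyMeasurable.mul hF.aestronglyMeasurable)
      (Filter.Eventually.of_forall fun x => ?_)
    rw [norm_mul]
    exact mul_le_of_le_one_left (norm_nonneg _) (hb _)
  have key := gaussian_ibp NC τ e he lam hlam hτ hNC
    (fun x => g ⟪x, u⟫ * Real.exp (-U x))
    (fun x => g' ⟪x, u⟫ * (Real.exp (-U x) * ⟪e, u⟫) - g ⟪x, u⟫ * (Real.exp (-U x) * ⟪e, DU x⟫))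
    (by
      intro z t
      have k1 : HasDerivAt (fun t : ℝ => z + t • e) e t := by
        simpa using ((hasDerivAt_id t).smul_const e).const_add z
      have k2 : HasDerivAt (fun t : ℝ => U (z + t • e)) ⟪DU (z + t • e), e⟫ t := by
        have := (hU (z + t • e)).comp_hasDerivAt t k1
        exact HasDerivAt.congr_deriv this (by simp)
      have k3 : HasDerivAt (fun t : ℝ => ⟪z + t • e, u⟫) ⟪e, u⟫ t := by
        have := (innerSL ℝ u).hasFDerivAt.comp_hasDerivAt t k1
        refine HasDerivAt.congr_deriv (this.congr_of_eventuallyEq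
          (Filter.Eventually.of_forall fun s => ?_)) ?_
        · simp [real_inner_comm]
        · simp [real_inner_comm]
      have k4 := ((hg _).comp t k3).mul (k2.neg.exp)
      refine k4.congr_deriv ?_
      simp only [Function.comp, Pi.neg_apply, real_inner_comm e (DU _)]
      ring)
    (hmulb g _ hgc hgb hexpU)
    ((hmulb g' _ hg'c hgb' (hexpU.mul_const _)).sub (hmulb g _ hgc hgb h1))
    (by
      refine (hmulb g _ hgc hgb h2).congr (Filter.Eventually.of_forall fun x => ?_)
      simp only; ring)
  rw [← key]
  congr 1; funext x
  ring
end target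
section final
variable {X : Type*} [NormedAddCommGroup X] [InnerProductSpace ℝ X] [CompleteSpace X]
    [MeasurableSpace X] [BorelSpace X] [SecondCountableTopology X]

lemma integrable_bdd_mul (Q : Measure X) (φ : ℝ → ℝ) (hφ : Continuous φ) (hb : ∀ t, |φ t| ≤ 1)
    (u : X) (F : X → ℝ) (hF : Integrable F Q) : Integrable (fun x => φ ⟪x, u⟫ * F x) Q := by
  have hc : Continuous fun x : X => φ ⟪x, u⟫ := by fun_prop
  refine Integrable.mono' hF.norm (hc.aestronglyMeasurable.mul hF.aestronglyMeasurable)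
    (Filter.Eventually.of_forall fun x => ?_)
  rw [norm_mul]
  exact mul_le_of_le_one_left (norm_nonneg _) (hb _)

lemma integral_cexp_mul (Q : Measure X) (u : X) (w : X → ℝ) (hw : Integrable w Q) :
    ∫ x, cexp (⟪x, u⟫ * I) * (w x : ℂ) ∂Q
      = ((∫ x, Real.cos ⟪x, u⟫ * w x ∂Q : ℝ) : ℂ) + ((∫ x, Real.sin ⟪x, u⟫ * w x ∂Q : ℝ) : ℂ) * I := by
  have h1 := integrable_bdd_mul Q Real.cos Real.continuous_cos Real.abs_cos_le_one u w hw
  have h2 := integrable_bdd_mul Q Real.sin Real.continuous_sin Real.abs_sin_le_one u w hw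
  have h1c : Integrable (fun x => ((Real.cos ⟪x, u⟫ * w x : ℝ) : ℂ)) Q := h1.ofReal
  have h2c : Integrable (fun x => ((Real.sin ⟪x, u⟫ * w x : ℝ) : ℂ) * I) Q :=
    Integrable.mul_const (f := fun x => ((Real.sin ⟪x, u⟫ * w x : ℝ) : ℂ)) h2.ofReal I
  rw [← integral_complex_ofReal, ← integral_complex_ofReal, ← integral_mul_const,
    ← integral_add h1c h2c]
  congr 1; funext x
  rw [Complex.exp_mul_I]
  push_cast
  ring

lemma feature_components (C : X →L[ℝ] X) (hsym : ∀ x y, ⟪C x, y⟫ = ⟪x, C y⟫)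
    (e : X) (lam : ℝ) (hCe : C e = lam • e) (DU : X → X) (Q : Measure X) [IsProbabilityMeasure Q]
    (hbm : Measurable fun x => x + C (DU x)) (hb : Integrable (fun x => x + C (DU x)) Q) (u : X) :
    ⟪e, ∫ x, feaA C (fun x => x + C (DU x)) x u ∂Q⟫
        = ∫ x, (Real.cos ⟪x, u⟫ * (⟪e, x⟫ + lam * ⟪e, DU x⟫) + lam * ⟪e, u⟫ * Real.sin ⟪x, u⟫) ∂Q ∧
    ⟪e, ∫ x, feaB C (fun x => x + C (DU x)) x u ∂Q⟫
        = ∫ x, (lam * ⟪e, u⟫ * Real.cos ⟪x, u⟫ - Real.sin ⟪x, u⟫ * (⟪e, x⟫ + lam * ⟪e, DU x⟫)) ∂Q := by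
  have hC : ∀ y, ⟪e, C y⟫ = lam * ⟪e, y⟫ := by
    intro y; rw [← hsym, hCe, real_inner_smul_left]
  have hdom : Integrable (fun x => ‖C u‖ + ‖x + C (DU x)‖) Q := (integrable_const _).add hb.norm
  have hA : Integrable (fun x => feaA C (fun x => x + C (DU x)) x u) Q :=
    Integrable.mono' hdom
      (measurable_feaA C _ hbm _ _ measurable_id measurable_const).aestronglyMeasurable
      (Filter.Eventually.of_forall fun x => norm_feaA_le C _ x u)
  have hB : Integrable (fun x => feaB C (fun x => x + C (DU x)) x u) Q :=
    Integrable.mono' hdom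
      (measurable_feaB C _ hbm _ _ measurable_id measurable_const).aestronglyMeasurable
      (Filter.Eventually.of_forall fun x => norm_feaB_le C _ x u)
  rw [← integral_inner hA, ← integral_inner hB]
  constructor
  · congr 1; funext x
    simp only [feaA, inner_add_right, real_inner_smul_right, hC]
    ring
  · congr 1; funext x
    simp only [feaB, inner_add_right, inner_sub_right, real_inner_smul_right, hC]
    ring

end final
/-- **Separation property of the vectorised kernel Stein discrepancy**
(Theorem 3, second part). -/
theorem ksd_vectorised_separates
    {X : Type*} [NormedAddCommGroup X] [InnerProductSpace ℝ X] [CompleteSpace X]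
    [MeasurableSpace X] [BorelSpace X] [SecondCountableTopology X]
    -- the covariance operator and its eigendecomposition
    (C : X →L[ℝ] X) (hCsa : IsSelfAdjoint C)
    (e : HilbertBasis ℕ ℝ X) (l : ℕ → ℝ) (hl : ∀ i, 0 < l i)
    (hCe : ∀ i, C (e i) = l i • e i) (hltr : Summable l)
    -- the potential `U` and its gradient `DU`
    (U : X → ℝ) (DU : X → X)
    (hU : ∀ x, HasFDerivAt U ((InnerProductSpace.toDual ℝ X) (DU x) : X →L[ℝ] ℝ) x)
    -- the Gaussian reference measure `N_C`
    (NC : Measure X) [IsProbabilityMeasure NC]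
    (hNC : ∀ y : X, Measure.map (fun x => ⟪y, x⟫) NC
      = gaussianReal 0 (Real.toNNReal ⟪C y, y⟫))
    -- the Gibbs target measure `P ∝ e^{-U} N_C`
    (hexpU : Integrable (fun x => Real.exp (-U x)) NC)
    (hZpos : 0 < ∫ x, Real.exp (-U x) ∂NC)
    (P : Measure X) [IsProbabilityMeasure P]
    (hP : P = (ENNReal.ofReal (∫ x, Real.exp (-U x) ∂NC))⁻¹ •
        NC.withDensity (fun x => ENNReal.ofReal (Real.exp (-U x))))
    -- the square root `C^{1/2}` of `C` and the Malliavin-type integrability conditions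
    (Csqrt : X →L[ℝ] X) (hCsqrt : ∀ i, Csqrt (e i) = Real.sqrt (l i) • e i)
    (hDU1 : Integrable (fun x => ‖Csqrt (DU x)‖ ^ 2) NC)
    (hDU2 : Integrable (fun x => Real.exp (-U x) * ‖Csqrt (DU x)‖ ^ 2) NC)
    -- the candidate measure `Q` and its moment conditions
    (Q : Measure X) [IsProbabilityMeasure Q]
    (hQ2 : Integrable (fun x => ‖x‖ ^ 2) Q)
    (hQU : Integrable (fun x => ‖C (DU x)‖) Q)
    -- the spectral measure `μ` (with full support) and the kernel `k`
    (μ : Measure X) [IsFiniteMeasure μ]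
    (hμsymm : Measure.map (fun u => -u) μ = μ)
    (hμ2 : Integrable (fun s => ‖s‖ ^ 2) μ)
    (hμsupp : ∀ B : Set X, IsOpen B → B.Nonempty → 0 < μ B)
    (k : X → X → ℝ)
    (hk : ∀ x y : X, (k x y : ℂ) = ∫ u, Complex.exp ((⟪x - y, u⟫ : ℂ) * Complex.I) ∂μ) :
    ∫ x, ∫ x', steinKernelHv k C DU (fun i => e i) l x x' ∂Q ∂Q = 0 ↔ Q = P := by
  have hsym : ∀ x y, ⟪C x, y⟫ = ⟪x, C y⟫ := fun x y =>
    (ContinuousLinearMap.isSelfAdjoint_iff_isSymmetric.1 hCsa) x y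
  have hDUm : Measurable DU := measurable_grad U DU hU
  have hUc : Continuous U := continuous_iff_continuousAt.2 fun x => (hU x).continuousAt
  have hUm : Measurable U := hUc.measurable
  have hbm : Measurable fun x => x + C (DU x) := by fun_prop
  have hCm : Measurable fun x => C (DU x) := by fun_prop
  have hQ1 : Integrable (fun x : X => x) Q := by
    refine Integrable.mono' ((integrable_const (1:ℝ)).add hQ2)
      measurable_id.aestronglyMeasurable (Filter.Eventually.of_forall fun u => ?_)
    simp only [Pi.add_apply]
    nlinarith [sq_nonneg (‖u‖ - 1)]
  have hQC : Integrable (fun x => C (DU x)) Q :=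
    (integrable_norm_iff hCm.aestronglyMeasurable).1 hQU
  have hb : Integrable (fun x => x + C (DU x)) Q := hQ1.add hQC
  have hnorm : ∀ j, ‖e j‖ = 1 := fun j => e.orthonormal.1 j
  have hlr : ∀ j, ((Real.toNNReal (l j) : NNReal) : ℝ) = l j := fun j =>
    Real.coe_toNNReal _ (hl j).le
  have hl0 : ∀ j, Real.toNNReal (l j) ≠ 0 := fun j => by simpa using hl j
  have hCe' : ∀ j, C (e j) = ((Real.toNNReal (l j) : NNReal) : ℝ) • e j := fun j => by
    rw [hlr, hCe]
  have hpos : ∀ y : X, 0 ≤ ⟪C y, y⟫ := by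
    intro y
    refine (e.hasSum_inner_mul_inner (C y) y).nonneg fun j => ?_
    rw [hsym, hCe, real_inner_smul_right, real_inner_comm (e j) y]
    have := (hl j).le
    nlinarith [mul_nonneg this (mul_self_nonneg ⟪e j, y⟫)]
  have hfac := fun j => gaussian_factor C hCsa NC hpos hNC (e j) (hnorm j) (Real.toNNReal (l j))
    (hCe' j)
  have hτ0 : ∀ j, ∀ᵐ z ∂(NC.map (fun x => x - ⟪e j, x⟫ • e j)), ⟪e j, z⟫ = 0 := by
    intro j
    rw [ae_map_iff (by fun_prop) (measurableSet_eq_fun (by fun_prop) (by fun_prop))]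
    refine Filter.Eventually.of_forall fun x => ?_
    rw [inner_sub_right, real_inner_smul_right, real_inner_self_eq_norm_sq, hnorm]; ring
  have hcomp := fun j u => feature_components C hsym (e j) (l j) (hCe j) DU Q hbm hb u
  simp only [hv_formula C hCsa e l hCe DU μ hμ2 k hk]
  rw [double_integral C _ hbm Q μ hb hμ2 hμsupp]
  constructor
  · intro h
    have hinst : ∀ j, IsProbabilityMeasure (NC.map (fun x => x - ⟪e j, x⟫ • e j)) := fun j =>
      Measure.isProbabilityMeasure_map (by fun_prop)
    refine gibbs_unique e U hUc NC Q P _ hZpos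
      (ofReal_integral_eq_lintegral_ofReal hexpU
        (Filter.Eventually.of_forall fun x => (Real.exp_pos _).le)).symm hP fun j => ?_
    have hβ : ∀ x, ⟪e j, x⟫ / ((Real.toNNReal (l j) : NNReal) : ℝ) + ⟪e j, DU x⟫
        = (l j)⁻¹ * ⟪e j, x + C (DU x)⟫ := by
      intro x
      rw [hlr, inner_add_right, ← hsym, hCe, real_inner_smul_left]
      have := (hl j).ne'
      field_simp
    have hbj : Integrable (fun x => ⟪e j, x⟫ + l j * ⟪e j, DU x⟫) Q := by
      refine (hb.const_inner (𝕜 := ℝ) (e j)).congr (Filter.Eventually.of_forall fun x => ?_)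
      simp only [inner_add_right]
      rw [← hsym, hCe, real_inner_smul_left]
    have hβi : Integrable (fun x => ⟪e j, x⟫ / ((Real.toNNReal (l j) : NNReal) : ℝ)
        + ⟪e j, DU x⟫) Q := by
      simp only [hβ]
      exact (hb.const_inner (𝕜 := ℝ) (e j)).const_mul _
    have hone : Integrable (fun _ : X => (1:ℝ)) Q := integrable_const _
    obtain ⟨τ, hτs, hτz, hτ⟩ := exists_factor Q U DU hU (e j) (hnorm j) (Real.toNNReal (l j))
      (hl0 j) hβi (by
        intro u
        obtain ⟨hA, hB⟩ := hcomp j u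
        rw [(h u).1, inner_zero_right] at hA
        rw [(h u).2, inner_zero_right] at hB
        have ic := integrable_bdd_mul Q Real.cos Real.continuous_cos Real.abs_cos_le_one u _ hbj
        have is := integrable_bdd_mul Q Real.sin Real.continuous_sin Real.abs_sin_le_one u _ hbj
        have ic1 := integrable_bdd_mul Q Real.cos Real.continuous_cos Real.abs_cos_le_one u _ hone
        have is1 := integrable_bdd_mul Q Real.sin Real.continuous_sin Real.abs_sin_le_one u _ hone
        simp only [mul_one] at ic1 is1
        rw [integral_add ic (is1.const_mul _), integral_const_mul] at hA
        rw [integral_sub (ic1.const_mul _) is, integral_const_mul] at hB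
        have hch : charFun Q u = ((∫ x, Real.cos ⟪x, u⟫ ∂Q : ℝ) : ℂ)
            + ((∫ x, Real.sin ⟪x, u⟫ ∂Q : ℝ) : ℂ) * I := by
          rw [charFun_apply]
          have := integral_cexp_mul Q u (fun _ => 1) hone
          simpa using this
        rw [integral_cexp_mul Q u _ hβi, hch]
        have hlne := (hl j).ne'
        have r1 : ∫ x, Real.cos ⟪x, u⟫ * (⟪e j, x⟫ / ((Real.toNNReal (l j) : NNReal) : ℝ)
            + ⟪e j, DU x⟫) ∂Q = -(⟪e j, u⟫ * ∫ x, Real.sin ⟪x, u⟫ ∂Q) := by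
          have : ∀ x, Real.cos ⟪x, u⟫ * (⟪e j, x⟫ / ((Real.toNNReal (l j) : NNReal) : ℝ)
            + ⟪e j, DU x⟫) = (l j)⁻¹ * (Real.cos ⟪x, u⟫ * (⟪e j, x⟫ + l j * ⟪e j, DU x⟫)) := by
            intro x; rw [hlr]; field_simp
          simp only [this]
          rw [integral_const_mul]
          field_simp
          linarith
        have r2 : ∫ x, Real.sin ⟪x, u⟫ * (⟪e j, x⟫ / ((Real.toNNReal (l j) : NNReal) : ℝ)
            + ⟪e j, DU x⟫) ∂Q = ⟪e j, u⟫ * ∫ x, Real.cos ⟪x, u⟫ ∂Q := by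
          have : ∀ x, Real.sin ⟪x, u⟫ * (⟪e j, x⟫ / ((Real.toNNReal (l j) : NNReal) : ℝ)
            + ⟪e j, DU x⟫) = (l j)⁻¹ * (Real.sin ⟪x, u⟫ * (⟪e j, x⟫ + l j * ⟪e j, DU x⟫)) := by
            intro x; rw [hlr]; field_simp
          simp only [this]
          rw [integral_const_mul]
          field_simp
          linarith
        rw [r1, r2]
        apply Complex.ext <;> simp)
    have := hinst j
    exact swap_preserving (e j) (hnorm j) _ NC τ _ (gaussianReal 0 (Real.toNNReal (l j)))
      hτz (hτ0 j) hτ (hfac j)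
  · intro hQP u
    subst hQP
    set Z := ∫ x, Real.exp (-U x) ∂NC with hZ
    have hdm : Measurable fun x => ENNReal.ofReal (Real.exp (-U x)) := by fun_prop
    have hlt : ∀ᵐ x ∂NC, ENNReal.ofReal (Real.exp (-U x)) < ⊤ :=
      Filter.Eventually.of_forall fun x => ENNReal.ofReal_lt_top
    have hintegr : ∀ F : X → ℝ, ∫ x, F x ∂Q = (ENNReal.ofReal Z)⁻¹.toReal
        * ∫ x, Real.exp (-U x) * F x ∂NC := by
      intro F
      rw [hP, integral_smul_measure, integral_withDensity_eq_integral_toReal_smul hdm hlt]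
      simp only [ENNReal.toReal_ofReal (Real.exp_pos _).le, smul_eq_mul]
    have hintg : ∀ F : X → ℝ, Integrable F Q → Integrable (fun x => Real.exp (-U x) * F x) NC := by
      intro F hF
      rw [hP, integrable_smul_measure (by simp) (by simpa using hZpos),
        integrable_withDensity_iff_integrable_smul' hdm hlt] at hF
      simpa only [ENNReal.toReal_ofReal (Real.exp_pos _).le, smul_eq_mul] using hF
    have h2 : ∀ j, Integrable (fun x => Real.exp (-U x) * ⟪e j, x⟫) NC := fun j =>
      hintg _ (hQ1.const_inner (𝕜 := ℝ) (e j))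
    have h1 : ∀ j, Integrable (fun x => Real.exp (-U x) * ⟪e j, DU x⟫) NC := by
      intro j
      refine Integrable.mono' (hexpU.add (hDU2.const_mul (l j)⁻¹))
        (by apply Measurable.aestronglyMeasurable; fun_prop)
        (Filter.Eventually.of_forall fun x => ?_)
      have k1 : l j * ⟪e j, DU x⟫ ^ 2 ≤ ‖Csqrt (DU x)‖ ^ 2 := by
        have k2 := abs_real_inner_le_norm (e j) (Csqrt (DU x))
        rw [inner_Csqrt e l Csqrt hCsqrt, hnorm, one_mul] at k2
        have k3 := pow_le_pow_left₀ (abs_nonneg _) k2 2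
        rwa [sq_abs, mul_pow, Real.sq_sqrt (hl j).le] at k3
      have k4 : |⟪e j, DU x⟫| ≤ 1 + (l j)⁻¹ * ‖Csqrt (DU x)‖ ^ 2 := by
        have k5 : ⟪e j, DU x⟫ ^ 2 ≤ (l j)⁻¹ * ‖Csqrt (DU x)‖ ^ 2 := by
          rw [inv_mul_eq_div, le_div_iff₀ (hl j)]; linarith
        nlinarith [sq_nonneg (|⟪e j, DU x⟫| - 1), sq_abs ⟪e j, DU x⟫]
      rw [norm_mul, Real.norm_of_nonneg (Real.exp_pos _).le, Real.norm_eq_abs]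
      simp only [Pi.add_apply]
      calc Real.exp (-U x) * |⟪e j, DU x⟫|
          ≤ Real.exp (-U x) * (1 + (l j)⁻¹ * ‖Csqrt (DU x)‖ ^ 2) :=
            mul_le_mul_of_nonneg_left k4 (Real.exp_pos _).le
        _ = _ := by ring
    have hinst : ∀ j, IsProbabilityMeasure (NC.map (fun x => x - ⟪e j, x⟫ • e j)) := fun j =>
      Measure.isProbabilityMeasure_map (by fun_prop)
    constructor
    · refine hilbert_eq_zero e _ fun j => ?_
      have := hinst j
      have key := target_component NC _ U DU hU (e j) (hnorm j) _ (hl0 j) (hτ0 j) (hfac j) hexpU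
        (h1 j) (h2 j) Real.cos (fun t => -Real.sin t) Real.hasDerivAt_cos (by fun_prop)
        Real.abs_cos_le_one (fun t => by rw [abs_neg]; exact Real.abs_sin_le_one t) u
      rw [(hcomp j u).1, hintegr]
      rw [hlr] at key
      have e1 : ∫ x, Real.exp (-U x) * (Real.cos ⟪x, u⟫ * (⟪e j, x⟫ + l j * ⟪e j, DU x⟫)
          + l j * ⟪e j, u⟫ * Real.sin ⟪x, u⟫) ∂NC = -0 := by
        rw [← key, ← integral_neg]
        congr 1; funext x; ring
      rw [e1]; simp
    · refine hilbert_eq_zero e _ fun j => ?_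
      have := hinst j
      have key := target_component NC _ U DU hU (e j) (hnorm j) _ (hl0 j) (hτ0 j) (hfac j) hexpU
        (h1 j) (h2 j) Real.sin Real.cos Real.hasDerivAt_sin (by fun_prop)
        Real.abs_sin_le_one Real.abs_cos_le_one u
      rw [(hcomp j u).2, hintegr]
      rw [hlr] at key
      rw [key, mul_zero]
end
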